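/- arXiv:0707.0831 — 8 statements merged into one kernel-verified Lean document; each statement's English description precedes it below -/
import Mathlib

section
/- For every (α,θ) ∈ Ω and every x ∈ [−1,1], one has P_{α,θ}(x) > 0. -/
open Real Filter

noncomputable def Ccoef (α θ : ℝ) : ℝ := Real.sin (2 * θ) / (2 * α)

noncomputable def Ppoly (α θ x : ℝ) : ℝ :=
  α ^ 2 + Real.cos (2 * θ) * x ^ 2 - Ccoef α θ ^ 2 * x ^ 4

noncomputable def thetaPlus (α : ℝ) : ℝ :=
  if 1 < α then Real.pi / 2 else (1 / 2) * Real.arccos (1 - 2 * α ^ 2)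

def inOmega (α θ : ℝ) : Prop := 0 < α ∧ -thetaPlus α < θ ∧ θ < thetaPlus α

noncomputable def Lint (α θ : ℝ) : ℝ :=
  ∫ x in (-1 : ℝ)..1,
    (2 * α * Ccoef α θ ^ 2 * x ^ 2 - α * Real.cos (2 * θ)
        + Ccoef α θ ^ 2 * x ^ 2 * Real.sqrt (Ppoly α θ x)) /
      (Real.sqrt ((1 - x ^ 2) * Ppoly α θ x) * (α + Real.sqrt (Ppoly α θ x)))

/-- Wirtinger derivative `f_z = (f_u - i f_v)/2` of a map `f : ℝ² → ℂ`. -/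
noncomputable def wz (f : ℝ × ℝ → ℂ) (p : ℝ × ℝ) : ℂ :=
  (deriv (fun t => f (t, p.2)) p.1 - Complex.I * deriv (fun t => f (p.1, t)) p.2) / 2

/-- Wirtinger derivative `f_z̄ = (f_u + i f_v)/2` of a map `f : ℝ² → ℂ`. -/
noncomputable def wzbar (f : ℝ × ℝ → ℂ) (p : ℝ × ℝ) : ℂ :=
  (deriv (fun t => f (t, p.2)) p.1 + Complex.I * deriv (fun t => f (p.1, t)) p.2) / 2

theorem one_sub_lt_cos_of_inOmega {α θ : ℝ} (hΩ : inOmega α θ) :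
    1 - 2 * α ^ 2 < Real.cos (2 * θ) := by
  obtain ⟨hα, hl, hu⟩ := hΩ
  unfold thetaPlus at hl hu
  split_ifs at hl hu with h
  · nlinarith [Real.neg_one_le_cos (2 * θ)]
  · have habs : |2 * θ| < Real.arccos (1 - 2 * α ^ 2) := by
      rw [abs_lt]
      constructor <;> linarith
    have hcos := Real.cos_lt_cos_of_nonneg_of_le_pi (abs_nonneg _) (Real.arccos_le_pi _) habs
    rwa [Real.cos_abs, Real.cos_arccos (by nlinarith) (by nlinarith)] at hcos

theorem four_mul_sq_mul_Ppoly {α : ℝ} (hα : α ≠ 0) (θ x : ℝ) :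
    4 * α ^ 2 * Ppoly α θ x =
      (2 * α ^ 2 - (1 - Real.cos (2 * θ)) * x ^ 2) *
        (2 * α ^ 2 + (1 + Real.cos (2 * θ)) * x ^ 2) := by
  unfold Ppoly Ccoef
  rw [div_pow, Real.sin_sq]
  field_simp
  ring

/-- For every `(α, θ) ∈ Ω` and every `x ∈ [-1, 1]`, one has `P_{α,θ}(x) > 0`. -/
theorem statement_0 {α θ : ℝ} (hΩ : inOmega α θ) {x : ℝ}
    (hx : x ∈ Set.Icc (-1 : ℝ) 1) :
    0 < Ppoly α θ x := by
  have hα : 0 < α := hΩ.1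
  have hcos := one_sub_lt_cos_of_inOmega hΩ
  have hx2 : x ^ 2 ≤ 1 := by nlinarith [hx.1, hx.2]
  have h₁ : 0 < 2 * α ^ 2 - (1 - Real.cos (2 * θ)) * x ^ 2 := by
    nlinarith [mul_le_of_le_one_right (sub_nonneg.2 (Real.cos_le_one (2 * θ))) hx2]
  have h₂ : 0 < 2 * α ^ 2 + (1 + Real.cos (2 * θ)) * x ^ 2 := by
    have : 0 ≤ 1 + Real.cos (2 * θ) := by linarith [Real.neg_one_le_cos (2 * θ)]
    positivity
  refine pos_of_mul_pos_right (a := 4 * α ^ 2) ?_ (by positivity)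
  rw [four_mul_sq_mul_Ppoly hα.ne']
  exact mul_pos h₁ h₂
end

section
/- Let (α,θ) ∈ Ω and let φ be as in the context. Then φ'(u) < 0 for every u ∈ ℝ, and φ is a strictly decreasing bijection from ℝ onto ℝ. -/
open Real Filter

/-- On `Ω` the value of the quartic at `x = 1` is positive. -/
theorem Ppoly_one_pos {α θ : ℝ} (hΩ : inOmega α θ) : 0 < Ppoly α θ 1 := by
  obtain ⟨hα, h1, h2⟩ := hΩ
  have hc : 1 - 2 * α ^ 2 < Real.cos (2 * θ) := by
    unfold thetaPlus at h1 h2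
    split_ifs at h1 h2 with h
    · nlinarith [Real.neg_one_le_cos (2 * θ)]
    · have hlt : |2 * θ| < Real.arccos (1 - 2 * α ^ 2) := by
        rw [abs_lt]; constructor <;> linarith
      have hcos := Real.cos_lt_cos_of_nonneg_of_le_pi (abs_nonneg _) (Real.arccos_le_pi _) hlt
      rwa [Real.cos_abs, Real.cos_arccos (by nlinarith) (by nlinarith)] at hcos
  have hP : Ppoly α θ 1 = ((2 * α ^ 2 + Real.cos (2 * θ)) ^ 2 - 1) / (4 * α ^ 2) := by
    unfold Ppoly Ccoef
    have hs := Real.sin_sq_add_cos_sq (2 * θ)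
    field_simp
    linarith
  rw [hP]
  apply div_pos <;> nlinarith

/-- On `Ω` the quartic is bounded below on `[-1, 1]` by a positive constant. -/
theorem exists_pos_sq_le_Ppoly {α θ : ℝ} (hΩ : inOmega α θ) :
    ∃ k : ℝ, 0 < k ∧ ∀ x : ℝ, x ^ 2 ≤ 1 → k ^ 2 ≤ Ppoly α θ x := by
  have hα : 0 < α ^ 2 := pow_pos hΩ.1 2
  have hm : 0 < min (α ^ 2) (Ppoly α θ 1) := lt_min hα (Ppoly_one_pos hΩ)
  refine ⟨√(min (α ^ 2) (Ppoly α θ 1)), Real.sqrt_pos.2 hm, fun x hx => ?_⟩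
  rw [Real.sq_sqrt hm.le]
  have hconcave : (1 - x ^ 2) * α ^ 2 + x ^ 2 * Ppoly α θ 1 ≤ Ppoly α θ x := by
    have : 0 ≤ Ccoef α θ ^ 2 * (x ^ 2 * (1 - x ^ 2)) :=
      mul_nonneg (sq_nonneg _) (mul_nonneg (sq_nonneg _) (by linarith))
    unfold Ppoly
    linarith
  have h0 := mul_le_mul_of_nonneg_left (min_le_left (α ^ 2) (Ppoly α θ 1)) (sub_nonneg.2 hx)
  have h1 := mul_le_mul_of_nonneg_left (min_le_right (α ^ 2) (Ppoly α θ 1)) (sq_nonneg x)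
  linarith

/-- A function whose derivative is at most a negative constant is surjective. -/
theorem surjective_of_hasDerivAt_le_neg {f f' : ℝ → ℝ} {k : ℝ} (hk : 0 < k)
    (hf : ∀ u, HasDerivAt f (f' u) u) (hf' : ∀ u, f' u ≤ -k) : Function.Surjective f := by
  have hg : Antitone fun u => f u + k * u :=
    antitone_of_hasDerivAt_nonpos (fun u => (hf u).add ((hasDerivAt_id u).const_mul k))
      fun u => by simpa using by linarith [hf' u]
  have hcont : Continuous f := continuous_iff_continuousAt.2 fun u => (hf u).continuousAt
  refine hcont.surjective' ?_ ?_
  · refine tendsto_atTop_mono' _ ?_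
      (tendsto_atTop_add_const_left _ (f 0) (tendsto_id.const_mul_atBot_of_neg (neg_neg_of_pos hk)))
    filter_upwards [eventually_le_atBot 0] with u hu
    have := hg hu
    simp only [id] at *
    linarith
  · refine tendsto_atBot_mono' _ ?_
      (tendsto_atBot_add_const_left _ (f 0) (tendsto_id.const_mul_atTop_of_neg (neg_neg_of_pos hk)))
    filter_upwards [eventually_ge_atTop 0] with u hu
    have := hg hu
    simp only [id] at *
    linarith

/-- For `(α,θ) ∈ Ω` and `φ` a C¹ solution of `φ'² = P_{α,θ}(cos φ)`, `φ(0) = 0`, `φ'(0) ≤ 0`: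
`φ' < 0` everywhere, and `φ` is a strictly decreasing bijection of `ℝ` onto `ℝ`. -/
theorem statement_1 {α θ : ℝ} (hΩ : inOmega α θ) (φ φ' : ℝ → ℝ)
    (hφ : ∀ u, HasDerivAt φ (φ' u) u) (hφ'c : Continuous φ')
    (hode : ∀ u, (φ' u) ^ 2 = Ppoly α θ (Real.cos (φ u)))
    (hφ0 : φ 0 = 0) (hφ'0 : φ' 0 ≤ 0) :
    (∀ u, φ' u < 0) ∧ StrictAnti φ ∧ Function.Bijective φ := by
  obtain ⟨k, hk, hkP⟩ := exists_pos_sq_le_Ppoly hΩ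
  have hsq (u : ℝ) : k ^ 2 ≤ φ' u ^ 2 := hode u ▸ hkP _ (Real.cos_sq_le_one _)
  have hne (u : ℝ) : φ' u ≠ 0 := fun h => by
    have := hsq u
    rw [h] at this
    nlinarith
  have hneg (u : ℝ) : φ' u < 0 := by
    by_contra! hu
    obtain ⟨v, hv⟩ := mem_range_of_exists_le_of_exists_ge hφ'c ⟨0, hφ'0⟩ ⟨u, hu⟩
    exact hne v hv
  have hle (u : ℝ) : φ' u ≤ -k := by nlinarith [hsq u, hneg u]
  have hanti : StrictAnti φ := strictAnti_of_hasDerivAt_neg hφ hneg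
  exact ⟨hneg, hanti, hanti.injective, surjective_of_hasDerivAt_le_neg hk hφ hle⟩
end

section
/- Let (α,θ) ∈ Ω and let φ be as in the context. Then there exists a real number U > 0 such that φ(u+U) = φ(u) − π for all u ∈ ℝ, and moreover φ is odd: φ(−u) = −φ(u) for all u ∈ ℝ. -/
open Real Filter

/-- On `Ω` one has `1 < 2α² + cos 2θ`. -/
theorem one_lt_of_inOmega {α θ : ℝ} (hΩ : inOmega α θ) :
    1 < 2 * α ^ 2 + Real.cos (2 * θ) := by
  obtain ⟨hα, h1, h2⟩ := hΩ
  unfold thetaPlus at h1 h2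
  split_ifs at h1 h2 with h
  · nlinarith [Real.neg_one_le_cos (2 * θ)]
  · have habs : |2 * θ| < Real.arccos (1 - 2 * α ^ 2) := by
      rw [abs_lt]; constructor <;> linarith
    have hcos := Real.cos_lt_cos_of_nonneg_of_le_pi (abs_nonneg _) (Real.arccos_le_pi _) habs
    rw [Real.cos_abs, Real.cos_arccos (by nlinarith) (by nlinarith)] at hcos
    linarith

theorem Ppoly_one {α θ : ℝ} (hα : 0 < α) :
    Ppoly α θ 1 = ((2 * α ^ 2 + Real.cos (2 * θ)) ^ 2 - 1) / (4 * α ^ 2) := by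
  unfold Ppoly Ccoef
  field_simp
  nlinarith [Real.sin_sq_add_cos_sq (2 * θ)]

theorem Ppoly_pos {α θ x : ℝ} (hΩ : inOmega α θ) (hx : x ^ 2 ≤ 1) : 0 < Ppoly α θ x := by
  have hα := hΩ.1
  have hα2 : 0 < α ^ 2 := by positivity
  have h1 : 0 < Ppoly α θ 1 := by
    rw [Ppoly_one hα]
    have := one_lt_of_inOmega hΩ
    exact div_pos (by nlinarith) (by positivity)
  have hconcave : Ppoly α θ x = (1 - x ^ 2) * α ^ 2 + x ^ 2 * Ppoly α θ 1
      + Ccoef α θ ^ 2 * (x ^ 2 * (1 - x ^ 2)) := by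
    unfold Ppoly; ring
  have hrest : 0 ≤ Ccoef α θ ^ 2 * (x ^ 2 * (1 - x ^ 2)) :=
    mul_nonneg (sq_nonneg _) (mul_nonneg (sq_nonneg _) (by linarith))
  rcases hx.lt_or_eq with hlt | heq
  · nlinarith [mul_pos (sub_pos.2 hlt) hα2, mul_nonneg (sq_nonneg x) h1.le]
  · rw [hconcave, heq]; linarith

theorem Ppoly_cos_pos {α θ : ℝ} (hΩ : inOmega α θ) (t : ℝ) : 0 < Ppoly α θ (Real.cos t) :=
  Ppoly_pos hΩ (Real.cos_sq_le_one t)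

theorem Ppoly_neg (α θ x : ℝ) : Ppoly α θ (-x) = Ppoly α θ x := by
  unfold Ppoly; ring

/-- A continuous nowhere-zero function that is nonpositive somewhere is negative everywhere. -/
theorem neg_of_continuous_of_ne_zero {g : ℝ → ℝ} (hg : Continuous g) (hne : ∀ u, g u ≠ 0)
    {a : ℝ} (ha : g a ≤ 0) (u : ℝ) : g u < 0 := by
  by_contra! hu
  obtain ⟨c, hc⟩ := mem_range_of_exists_le_of_exists_ge hg ⟨a, ha⟩ ⟨u, hu⟩
  exact hne c hc

/-- The primitive from `0` of a positive continuous `f` inverts, up to sign, any solution of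
`φ' = -1 / f φ` with `φ 0 = 0`; if `f` is even and `T`-periodic, `φ` is odd and
quasi-periodic. -/
theorem quasiperiodic_and_odd_of_separable {f φ φ' : ℝ → ℝ} {T : ℝ} (hf : Continuous f)
    (hpos : ∀ t, 0 < f t) (heven : ∀ t, f (-t) = f t) (hper : Function.Periodic f T)
    (hT : 0 < T) (hφ : ∀ u, HasDerivAt φ (φ' u) u) (hsep : ∀ u, f (φ u) * φ' u = -1)
    (hφ0 : φ 0 = 0) :
    (∃ U : ℝ, 0 < U ∧ ∀ u, φ (u + U) = φ u - T) ∧ (∀ u, φ (-u) = -φ u) := by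
  set F : ℝ → ℝ := fun y => ∫ t in (0 : ℝ)..y, f t with hF
  have hFd (y : ℝ) : HasDerivAt F (f y) y := hf.integral_hasStrictDerivAt 0 y |>.hasDerivAt
  have hmono : StrictMono F :=
    strictMono_of_deriv_pos fun y => by rw [(hFd y).deriv]; exact hpos y
  have hF0 : F 0 = 0 := intervalIntegral.integral_same
  have hFneg (y : ℝ) : F (-y) = -F y := by
    have h := intervalIntegral.integral_comp_neg (a := 0) (b := y) f
    simp only [heven, neg_zero] at h
    simp only [hF]
    rw [intervalIntegral.integral_symm, ← h]
  have hFadd (y : ℝ) : F (y + T) = F y + F T := by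
    have h1 := intervalIntegral.integral_add_adjacent_intervals
      (hf.intervalIntegrable (μ := MeasureTheory.volume) 0 y) (hf.intervalIntegrable y (y + T))
    have h2 := hper.intervalIntegral_add_eq y 0
    rw [zero_add] at h2
    simp only [hF]
    rw [← h1, h2]
  have hinv (u : ℝ) : F (φ u) = -u := by
    have hd (v : ℝ) : HasDerivAt (fun v => F (φ v) + v) 0 v := by
      have := ((hFd (φ v)).comp v (hφ v)).add (hasDerivAt_id v)
      rw [hsep, neg_add_cancel] at this
      exact this
    have := is_const_of_deriv_eq_zero (fun v => (hd v).differentiableAt)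
      (fun v => (hd v).deriv) u 0
    simp only [hφ0, hF0] at this
    linarith
  refine ⟨⟨F T, hF0 ▸ hmono hT, fun u => hmono.injective ?_⟩, fun u => hmono.injective ?_⟩
  · have := hFadd (φ u - T)
    rw [sub_add_cancel, hinv] at this
    rw [hinv]; linarith
  · rw [hFneg, hinv, hinv]

/-- There exists `U > 0` with `φ(u + U) = φ(u) - π` for all `u`, and `φ` is odd. -/
theorem statement_2 {α θ : ℝ} (hΩ : inOmega α θ) (φ φ' : ℝ → ℝ)
    (hφ : ∀ u, HasDerivAt φ (φ' u) u) (hφ'c : Continuous φ')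
    (hode : ∀ u, (φ' u) ^ 2 = Ppoly α θ (Real.cos (φ u)))
    (hφ0 : φ 0 = 0) (hφ'0 : φ' 0 ≤ 0) :
    (∃ U : ℝ, 0 < U ∧ ∀ u, φ (u + U) = φ u - Real.pi) ∧
    (∀ u, φ (-u) = -φ u) := by
  have hP := Ppoly_cos_pos hΩ
  have hneg := neg_of_continuous_of_ne_zero hφ'c
    (fun u h => by have := hode u; rw [h] at this; linarith [hP (φ u)]) hφ'0
  refine quasiperiodic_and_odd_of_separable
    (f := fun t => (Real.sqrt (Ppoly α θ (Real.cos t)))⁻¹) (φ' := φ') ?_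
    (fun t => inv_pos.2 (Real.sqrt_pos.2 (hP t))) (fun t => by simp only [Real.cos_neg])
    (fun t => by simp only [Real.cos_add_pi, Ppoly_neg]) Real.pi_pos hφ (fun u => ?_) hφ0
  · refine Continuous.inv₀ ?_ fun t => (Real.sqrt_pos.2 (hP t)).ne'
    unfold Ppoly
    fun_prop
  · have hu := hneg u
    simp only [← hode, Real.sqrt_sq_eq_abs, abs_of_neg hu]
    field_simp [hu.ne]
end

section
/- Let (α,θ) ∈ Ω and let φ, β, G be as in the context. Then for all u ∈ ℝ the following identities hold: (i) φ'(u) + α = G'(u)·cos²φ(u); (ii) φ''(u) = −(cos(2θ) − 2C²·cos²φ(u))·sin φ(u)·cos φ(u); (iii) G''(u) = (C² + G'(u)²)·sin φ(u)·cos φ(u). -/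
open Real Filter

theorem one_sub_two_mul_sq_lt_cos_of_inOmega {α θ : ℝ} (h : inOmega α θ) :
    1 - 2 * α ^ 2 < Real.cos (2 * θ) := by
  obtain ⟨hα, h₁, h₂⟩ := h
  unfold thetaPlus at h₁ h₂
  split_ifs at h₁ h₂ with hα1
  · nlinarith [Real.neg_one_le_cos (2 * θ)]
  · have habs : |2 * θ| < Real.arccos (1 - 2 * α ^ 2) :=
      abs_lt.2 ⟨by linarith, by linarith⟩
    have hcos := Real.cos_lt_cos_of_nonneg_of_le_pi (abs_nonneg _) (Real.arccos_le_pi _) habs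
    rwa [Real.cos_abs, Real.cos_arccos (by nlinarith) (by nlinarith)] at hcos

theorem Ppoly_pos_of_inOmega {α θ x : ℝ} (h : inOmega α θ) (hx : x ^ 2 ≤ 1) :
    0 < Ppoly α θ x := by
  have hcos := one_sub_two_mul_sq_lt_cos_of_inOmega h
  have hα := h.1
  have hC : 4 * α ^ 2 * Ccoef α θ ^ 2 = 1 - Real.cos (2 * θ) ^ 2 := by
    rw [← Real.sin_sq, Ccoef]
    field_simp
    ring
  have hone : 0 < α ^ 2 + Real.cos (2 * θ) - Ccoef α θ ^ 2 := by
    have hprod : 0 < (2 * α ^ 2 + Real.cos (2 * θ) - 1) * (2 * α ^ 2 + Real.cos (2 * θ) + 1) := by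
      have := Real.neg_one_le_cos (2 * θ)
      have : 0 < α ^ 2 := by positivity
      apply mul_pos <;> linarith
    have h4 : 0 < 4 * α ^ 2 * (α ^ 2 + Real.cos (2 * θ) - Ccoef α θ ^ 2) := by
      linear_combination hprod + hC
    exact pos_of_mul_pos_right h4 (by positivity)
  have hconcave : Ppoly α θ x = (1 - x ^ 2) * α ^ 2
      + x ^ 2 * (α ^ 2 + Real.cos (2 * θ) - Ccoef α θ ^ 2)
      + Ccoef α θ ^ 2 * (x ^ 2 * (1 - x ^ 2)) := by
    unfold Ppoly; ring
  have hx0 := sq_nonneg x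
  have hx1 : 0 ≤ 1 - x ^ 2 := by linarith
  rw [hconcave]
  rcases hx0.eq_or_lt with h0 | h0
  · rw [← h0]
    nlinarith [pow_pos hα 2]
  · positivity

theorem neg_of_continuous_of_ne_zero_s5 {f : ℝ → ℝ} (hf : Continuous f) (hne : ∀ x, f x ≠ 0)
    {a : ℝ} (ha : f a ≤ 0) (x : ℝ) : f x < 0 := by
  by_contra! hx
  obtain ⟨y, hy⟩ := mem_range_of_exists_le_of_exists_ge hf ⟨a, ha⟩ ⟨x, hx⟩
  exact hne y hy

/-- The identities `φ' + α = G'·cos²φ`, `φ'' = -(cos 2θ - 2C²cos²φ)·sin φ·cos φ`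
and `G'' = (C² + G'²)·sin φ·cos φ`. -/
theorem statement_5 {α θ : ℝ} (hΩ : inOmega α θ) (φ φ' φ'' Gd Gdd : ℝ → ℝ)
    (hφ : ∀ u, HasDerivAt φ (φ' u) u)
    (hφ' : ∀ u, HasDerivAt φ' (φ'' u) u)
    (hode : ∀ u, (φ' u) ^ 2 = Ppoly α θ (Real.cos (φ u)))
    (hφ0 : φ 0 = 0) (hφ'0 : φ' 0 ≤ 0)
    (hGd : ∀ u, Gd u =
      (Ccoef α θ ^ 2 * Real.cos (φ u) ^ 2 - Real.cos (2 * θ)) / (α - φ' u))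
    (hGdd : ∀ u, HasDerivAt Gd (Gdd u) u) :
    ∀ u, φ' u + α = Gd u * Real.cos (φ u) ^ 2 ∧
      φ'' u = -((Real.cos (2 * θ) - 2 * Ccoef α θ ^ 2 * Real.cos (φ u) ^ 2) *
        Real.sin (φ u) * Real.cos (φ u)) ∧
      Gdd u = (Ccoef α θ ^ 2 + Gd u ^ 2) * Real.sin (φ u) * Real.cos (φ u) := by
  have hneg : ∀ u, φ' u < 0 :=
    neg_of_continuous_of_ne_zero_s5 (continuous_iff_continuousAt.2 fun u => (hφ' u).continuousAt)
      (fun u hu => by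
        have hpos := Ppoly_pos_of_inOmega hΩ (Real.cos_sq_le_one (φ u))
        rw [← hode u, hu] at hpos
        simp at hpos) hφ'0
  intro u
  have hp := hneg u
  have hα := hΩ.1
  have hd : α - φ' u ≠ 0 := by linarith
  have hodeu := hode u
  unfold Ppoly at hodeu
  have hcos := (hφ u).cos
  have hsecond : φ'' u = -((Real.cos (2 * θ) - 2 * Ccoef α θ ^ 2 * Real.cos (φ u) ^ 2) *
      Real.sin (φ u) * Real.cos (φ u)) := by
    have hL := (hφ' u).pow 2
    have hR := (((hcos.pow 2).const_mul (Real.cos (2 * θ))).const_add (α ^ 2)).sub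
      ((hcos.pow 4).const_mul (Ccoef α θ ^ 2))
    have heq := hL.unique (hR.congr_of_eventuallyEq (Eventually.of_forall fun v => by
      simpa [Ppoly] using hode v))
    norm_num at heq
    apply mul_left_cancel₀ hp.ne
    linear_combination heq / 2
  refine ⟨?_, hsecond, ?_⟩
  · rw [hGd u]
    field_simp
    linear_combination -hodeu
  · have hquot := (((hcos.pow 2).const_mul (Ccoef α θ ^ 2)).sub_const (Real.cos (2 * θ))).div
      ((hφ' u).const_sub α) hd
    have heq := (hGdd u).unique (hquot.congr_of_eventuallyEq (Eventually.of_forall fun v => by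
      simpa using hGd v))
    rw [heq, hGd u, hsecond]
    simp only [Pi.pow_apply]
    field_simp
    norm_num
    linear_combination (Ccoef α θ ^ 2 * Real.sin (φ u) * Real.cos (φ u)) * hodeu
end

section
/- For every α > 0 there exists a unique θ̃_α belonging to (0, θ⁺_α) ∩ (0, π/4) such that L(α, θ̃_α) = 0. -/
open Real Filter

open MeasureTheory Set in
theorem intervalIntegrable_inv_sqrt_one_sub_sq :
    IntervalIntegrable (fun x : ℝ => (√(1 - x ^ 2))⁻¹) volume (-1) 1 := by
  rw [intervalIntegrable_iff_integrableOn_Ioc_of_le (by norm_num)]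
  have h : ∀ x ∈ Ioo (-1 : ℝ) 1, HasDerivAt arcsin ((√(1 - x ^ 2))⁻¹) x := fun x hx => by
    simpa using hasDerivAt_arcsin hx.1.ne' hx.2.ne
  exact intervalIntegral.integrableOn_deriv_of_nonneg continuous_arcsin.continuousOn h
    fun x _ => by positivity

/-- The polynomial `Ppoly` in terms of `t = sin² θ`. -/
noncomputable def sinSqPoly (α t x : ℝ) : ℝ :=
  α ^ 2 + (1 - 2 * t) * x ^ 2 - t * (1 - t) / α ^ 2 * x ^ 4

/-- The integrand of `Lint` in terms of `t = sin² θ`. -/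
noncomputable def sinSqIntegrand (α t x : ℝ) : ℝ :=
  (2 * α * (t * (1 - t) / α ^ 2) * x ^ 2 - α * (1 - 2 * t)
      + t * (1 - t) / α ^ 2 * x ^ 2 * √(sinSqPoly α t x)) /
    (√((1 - x ^ 2) * sinSqPoly α t x) * (α + √(sinSqPoly α t x)))

theorem Lint_eq_integral_sinSqIntegrand (α θ : ℝ) :
    Lint α θ = ∫ x in (-1 : ℝ)..1, sinSqIntegrand α (sin θ ^ 2) x := by
  have h1 : cos (2 * θ) = 1 - 2 * sin θ ^ 2 := by rw [cos_two_mul, cos_sq']; ring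
  have h2 : Ccoef α θ ^ 2 = sin θ ^ 2 * (1 - sin θ ^ 2) / α ^ 2 := by
    rw [Ccoef, sin_two_mul, ← cos_sq']
    ring
  simp only [Lint, Ppoly, h1, h2, sinSqIntegrand, sinSqPoly]

section

variable {α t x : ℝ}

theorem sinSqPoly_eq (hα : 0 < α) :
    sinSqPoly α t x = (α ^ 2 - t * x ^ 2) * (α ^ 2 + (1 - t) * x ^ 2) / α ^ 2 := by
  unfold sinSqPoly
  field_simp
  ring

theorem sub_le_sinSqPoly (hα : 0 < α) (h0 : 0 ≤ t) (h1 : t ≤ 1 / 2) (h2 : t < α ^ 2)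
    (hx : x ^ 2 ≤ 1) : α ^ 2 - t ≤ sinSqPoly α t x := by
  rw [sinSqPoly_eq hα, le_div_iff₀ (by positivity)]
  have : t * x ^ 2 ≤ t := by nlinarith
  have : 0 ≤ (1 - t) * x ^ 2 := mul_nonneg (by linarith) (sq_nonneg x)
  apply mul_le_mul <;> nlinarith [sq_nonneg α]

theorem sinSqPoly_pos (hα : 0 < α) (h0 : 0 ≤ t) (h1 : t ≤ 1 / 2) (h2 : t < α ^ 2)
    (hx : x ^ 2 ≤ 1) : 0 < sinSqPoly α t x :=
  (sub_pos.2 h2).trans_le (sub_le_sinSqPoly hα h0 h1 h2 hx)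

theorem sinSqIntegrand_lt {t' : ℝ} (hα : 0 < α) (h0 : 0 ≤ t) (h : t < t') (h1 : t' ≤ 1 / 2)
    (h2 : t' < α ^ 2) (hx : x ^ 2 < 1) : sinSqIntegrand α t x < sinSqIntegrand α t' x := by
  rcases eq_or_ne x 0 with rfl | hx0
  · simp only [sinSqIntegrand, sinSqPoly]
    norm_num
    gcongr
  have key : ∀ s, 0 ≤ s → s ≤ 1 / 2 → s < α ^ 2 → sinSqIntegrand α s x =
      ((α ^ 2 + s * (1 - s) / α ^ 2 * x ^ 4) / √(sinSqPoly α s x) - α) / (x ^ 2 * √(1 - x ^ 2)) := by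
    intro s hs0 hs1 hs2
    have hP := sinSqPoly_pos hα hs0 hs1 hs2 hx.le
    have hr := sqrt_pos.2 hP
    have hw : 0 < √(1 - x ^ 2) := sqrt_pos.2 (by linarith)
    have hsq : √(sinSqPoly α s x) ^ 2 = sinSqPoly α s x := sq_sqrt hP.le
    rw [sinSqIntegrand, sqrt_mul (by linarith)]
    conv_rhs at hsq => rw [sinSqPoly]
    generalize √(sinSqPoly α s x) = r at *
    generalize √(1 - x ^ 2) = w at *
    generalize s * (1 - s) / α ^ 2 = D at *
    have hαr : 0 < α + r := by positivity
    rw [div_sub' hr.ne', div_div, div_eq_div_iff (by positivity) (by positivity)]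
    linear_combination (w * r * α) * hsq
  have hP' := sinSqPoly_pos hα (h0.trans h.le) h1 h2 hx.le
  have hD : t * (1 - t) / α ^ 2 < t' * (1 - t') / α ^ 2 := by
    gcongr ?_ / _
    nlinarith
  have hD0 : 0 ≤ t * (1 - t) / α ^ 2 := div_nonneg (by nlinarith) (by positivity)
  have hlt : sinSqPoly α t' x < sinSqPoly α t x := by
    unfold sinSqPoly
    have : t * (1 - t) / α ^ 2 * x ^ 4 < t' * (1 - t') / α ^ 2 * x ^ 4 := by gcongr
    have : 2 * t * x ^ 2 < 2 * t' * x ^ 2 := by gcongr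
    linarith
  have hw : 0 < √(1 - x ^ 2) := sqrt_pos.2 (by linarith)
  have hr' := sqrt_pos.2 hP'
  have hD0' := hD0.trans hD.le
  have hnum : 0 ≤ α ^ 2 + t' * (1 - t') / α ^ 2 * x ^ 4 := by positivity
  rw [key t h0 (h.le.trans h1) (h.trans h2), key t' (h0.trans h.le) h1 h2]
  gcongr

theorem abs_sinSqIntegrand_le {t₁ : ℝ} (hα : 0 < α) (h0 : 0 ≤ t) (h : t ≤ t₁) (h1 : t₁ ≤ 1 / 2)
    (h2 : t₁ < α ^ 2) (hx : x ^ 2 < 1) :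
    |sinSqIntegrand α t x| ≤ (3 / α ^ 2 + 1) / √(α ^ 2 - t₁) * (√(1 - x ^ 2))⁻¹ := by
  have hP := sub_le_sinSqPoly hα h0 (h.trans h1) (h.trans_lt h2) hx.le
  have hw : 0 < √(1 - x ^ 2) := sqrt_pos.2 (by linarith)
  have hm : 0 < √(α ^ 2 - t₁) := sqrt_pos.2 (by linarith)
  have hr : √(α ^ 2 - t₁) ≤ √(sinSqPoly α t x) := sqrt_le_sqrt (by linarith)
  have hD0 : 0 ≤ t * (1 - t) / α ^ 2 := div_nonneg (by nlinarith) (by positivity)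
  have hD : t * (1 - t) / α ^ 2 ≤ 1 / α ^ 2 := by gcongr; nlinarith
  rw [sinSqIntegrand, sqrt_mul (by linarith), show 3 / α ^ 2 = 3 * (1 / α ^ 2) by ring]
  generalize √(sinSqPoly α t x) = r at *
  generalize √(1 - x ^ 2) = w at *
  generalize √(α ^ 2 - t₁) = m at *
  generalize t * (1 - t) / α ^ 2 = D at *
  generalize 1 / α ^ 2 = E at *
  have hr0 : 0 < r := hm.trans_le hr
  have hE : 0 ≤ E := hD0.trans hD
  have hnum : |2 * α * D * x ^ 2 - α * (1 - 2 * t) + D * x ^ 2 * r| ≤ (3 * E + 1) * (α + r) := by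
    have hDx0 : 0 ≤ D * x ^ 2 := by positivity
    have hDx : D * x ^ 2 ≤ E := by nlinarith
    have e1 : α * (D * x ^ 2) ≤ α * E := by gcongr
    have e2 : r * (D * x ^ 2) ≤ r * E := by gcongr
    have e3 : 0 ≤ α * t := by positivity
    have e4 : α * t ≤ α * (1 / 2) := by gcongr; linarith
    have e5 : 0 ≤ α * (D * x ^ 2) := by positivity
    have e6 : 0 ≤ r * (D * x ^ 2) := by positivity
    rw [abs_le]
    constructor <;> nlinarith
  have hαr : 0 < α + r := by positivity
  rw [abs_div, abs_of_pos (show 0 < w * r * (α + r) by positivity), ← div_eq_mul_inv, div_div,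
    div_le_div_iff₀ (by positivity) (by positivity)]
  calc _ ≤ (3 * E + 1) * (α + r) * (r * w) := by gcongr
    _ = _ := by ring

theorem measurable_sinSqIntegrand (α t : ℝ) : Measurable (sinSqIntegrand α t) := by
  unfold sinSqIntegrand sinSqPoly
  fun_prop

theorem continuousAt_sinSqIntegrand (hα : 0 < α) (h0 : 0 ≤ t) (h1 : t ≤ 1 / 2) (h2 : t < α ^ 2)
    (hx : x ^ 2 < 1) : ContinuousAt (fun s => sinSqIntegrand α s x) t := by
  have hP := sinSqPoly_pos hα h0 h1 h2 hx.le
  have hx' : 0 < 1 - x ^ 2 := by linarith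
  have hc : Continuous fun s => sinSqPoly α s x := by unfold sinSqPoly; fun_prop
  unfold sinSqIntegrand
  exact ContinuousAt.div (by fun_prop) (by fun_prop) (by positivity)

theorem sq_lt_one_of_mem_Ioo (hx : x ∈ Set.Ioo (-1 : ℝ) 1) : x ^ 2 < 1 := by
  nlinarith [hx.1, hx.2]

theorem intervalIntegrable_sinSqIntegrand (hα : 0 < α) (h0 : 0 ≤ t) (h1 : t ≤ 1 / 2)
    (h2 : t < α ^ 2) : IntervalIntegrable (sinSqIntegrand α t) MeasureTheory.volume (-1) 1 := by
  have hb := intervalIntegrable_inv_sqrt_one_sub_sq.const_mul ((3 / α ^ 2 + 1) / √(α ^ 2 - t))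
  rw [intervalIntegrable_iff_integrableOn_Ioo_of_le (by norm_num)] at hb ⊢
  refine hb.mono' (measurable_sinSqIntegrand α t).aestronglyMeasurable ?_
  filter_upwards [MeasureTheory.ae_restrict_mem measurableSet_Ioo] with x hx
  exact abs_sinSqIntegrand_le hα h0 le_rfl h1 h2 (sq_lt_one_of_mem_Ioo hx)

theorem continuousOn_integral_sinSqIntegrand {t₁ : ℝ} (hα : 0 < α) (h1 : t₁ ≤ 1 / 2)
    (h2 : t₁ < α ^ 2) :
    ContinuousOn (fun t => ∫ x in (-1 : ℝ)..1, sinSqIntegrand α t x) (Set.Icc 0 t₁) := by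
  have hb := intervalIntegrable_inv_sqrt_one_sub_sq.const_mul ((3 / α ^ 2 + 1) / √(α ^ 2 - t₁))
  rw [intervalIntegrable_iff_integrableOn_Ioo_of_le (by norm_num)] at hb
  simp only [intervalIntegral.integral_of_le (show (-1 : ℝ) ≤ 1 by norm_num),
    MeasureTheory.integral_Ioc_eq_integral_Ioo]
  refine MeasureTheory.continuousOn_of_dominated
    (fun t _ => (measurable_sinSqIntegrand α t).aestronglyMeasurable) (fun t ht => ?_) hb ?_
  · filter_upwards [MeasureTheory.ae_restrict_mem measurableSet_Ioo] with x hx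
    exact abs_sinSqIntegrand_le hα ht.1 ht.2 h1 h2 (sq_lt_one_of_mem_Ioo hx)
  · filter_upwards [MeasureTheory.ae_restrict_mem measurableSet_Ioo] with x hx
    exact fun t ht => (continuousAt_sinSqIntegrand hα ht.1 (ht.2.trans h1) (ht.2.trans_lt h2)
      (sq_lt_one_of_mem_Ioo hx)).continuousWithinAt

theorem integral_sinSqIntegrand_lt {t' : ℝ} (hα : 0 < α) (h0 : 0 ≤ t) (h : t < t')
    (h1 : t' ≤ 1 / 2) (h2 : t' < α ^ 2) :
    ∫ x in (-1 : ℝ)..1, sinSqIntegrand α t x < ∫ x in (-1 : ℝ)..1, sinSqIntegrand α t' x := by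
  have hi := intervalIntegrable_sinSqIntegrand hα h0 (h.le.trans h1) (h.trans h2)
  have hi' := intervalIntegrable_sinSqIntegrand hα (h0.trans h.le) h1 h2
  rw [← sub_pos, ← intervalIntegral.integral_sub hi' hi]
  exact intervalIntegral.intervalIntegral_pos_of_pos_on (hi'.sub hi)
    (fun x hx => sub_pos.2 (sinSqIntegrand_lt hα h0 h h1 h2 (sq_lt_one_of_mem_Ioo hx)))
    (by norm_num)

theorem integral_sinSqIntegrand_zero_neg (hα : 0 < α) :
    ∫ x in (-1 : ℝ)..1, sinSqIntegrand α 0 x < 0 := by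
  have hα2 : 0 < α ^ 2 := by positivity
  rw [← neg_pos, ← intervalIntegral.integral_neg]
  refine intervalIntegral.intervalIntegral_pos_of_pos_on
    (intervalIntegrable_sinSqIntegrand hα le_rfl (by norm_num) hα2).neg (fun x hx => ?_)
    (by norm_num)
  have hx1 := sq_lt_one_of_mem_Ioo hx
  have hP := sinSqPoly_pos hα le_rfl (by norm_num) hα2 hx1.le
  have hx' : 0 < 1 - x ^ 2 := by linarith
  rw [sinSqIntegrand, ← neg_div]
  apply div_pos
  · simpa using hα
  · positivity

theorem integral_sinSqIntegrand_half_pos (hα : 0 < α) (h : 1 / 2 < α ^ 2) :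
    0 < ∫ x in (-1 : ℝ)..1, sinSqIntegrand α (1 / 2) x := by
  have hi := intervalIntegrable_sinSqIntegrand hα (by norm_num) le_rfl h
  have hpos : ∀ x ∈ Set.Ioo (-1 : ℝ) 1, x ≠ 0 → 0 < sinSqIntegrand α (1 / 2) x := by
    intro x hx hx0
    have hx1 := sq_lt_one_of_mem_Ioo hx
    have hP := sinSqPoly_pos hα (by norm_num) le_rfl h hx1.le
    have hx' : 0 < 1 - x ^ 2 := by linarith
    rw [sinSqIntegrand]
    norm_num
    norm_num at hP
    positivity
  have hi1 : IntervalIntegrable (sinSqIntegrand α (1 / 2)) MeasureTheory.volume (-1) 0 :=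
    hi.mono_set (by
      rw [Set.uIcc_of_le (by norm_num), Set.uIcc_of_le (by norm_num)]
      exact Set.Icc_subset_Icc le_rfl (by norm_num))
  have hi2 : IntervalIntegrable (sinSqIntegrand α (1 / 2)) MeasureTheory.volume 0 1 :=
    hi.mono_set (by
      rw [Set.uIcc_of_le (by norm_num), Set.uIcc_of_le (by norm_num)]
      exact Set.Icc_subset_Icc (by norm_num) le_rfl)
  rw [← intervalIntegral.integral_add_adjacent_intervals hi1 hi2]
  exact add_pos
    (intervalIntegral.intervalIntegral_pos_of_pos_on hi1
      (fun x hx => hpos x ⟨hx.1, by linarith [hx.2]⟩ hx.2.ne) (by norm_num))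
    (intervalIntegral.intervalIntegral_pos_of_pos_on hi2
      (fun x hx => hpos x ⟨by linarith [hx.1], hx.2⟩ hx.1.ne') (by norm_num))

theorem le_sinSqIntegrand {ε : ℝ} (hα : 0 < α) (hα2 : α ^ 2 ≤ 1 / 2) (hε : 0 < ε)
    (hε1 : ε ≤ 1 / 4) (hx : x ∈ Set.Ioo (-1 : ℝ) 1) :
    α / (4 * (α + 2)) * (ε + 2 * (1 - x))⁻¹ - 2 / α ≤
      sinSqIntegrand α (α ^ 2 * (1 - ε)) x := by
  have hx1 := sq_lt_one_of_mem_Ioo hx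
  have hx' : 0 < 1 - x ^ 2 := by linarith
  have hα0 : 0 < α ^ 2 := by positivity
  have hPeq : sinSqPoly α (α ^ 2 * (1 - ε)) x =
      (1 - (1 - ε) * x ^ 2) * (α ^ 2 + (1 - α ^ 2 * (1 - ε)) * x ^ 2) := by
    rw [sinSqPoly_eq hα]
    field_simp
  have hq : 1 - x ^ 2 ≤ 1 - (1 - ε) * x ^ 2 := by nlinarith [sq_nonneg x]
  have hq' : 1 - (1 - ε) * x ^ 2 ≤ ε + 2 * (1 - x) := by
    nlinarith [mul_nonneg hε.le hx'.le, sq_nonneg (1 - x)]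
  have hq1 : 1 - (1 - ε) * x ^ 2 ≤ 1 := by nlinarith [sq_nonneg x]
  have ht0 : 0 ≤ α ^ 2 * (1 - ε) := mul_nonneg hα0.le (by linarith)
  have ht1 : α ^ 2 * (1 - ε) ≤ 1 := by nlinarith
  have hs0 : α ^ 2 ≤ α ^ 2 + (1 - α ^ 2 * (1 - ε)) * x ^ 2 := by
    nlinarith [mul_nonneg (sub_nonneg.2 ht1) (sq_nonneg x)]
  have hs1 : α ^ 2 + (1 - α ^ 2 * (1 - ε)) * x ^ 2 ≤ 4 := by
    nlinarith [mul_nonneg ht0 (sq_nonneg x)]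
  have hr : √(sinSqPoly α (α ^ 2 * (1 - ε)) x) ≤ 2 := by
    rw [sqrt_le_left (by norm_num), hPeq]
    nlinarith
  have hr0 : 0 < √(sinSqPoly α (α ^ 2 * (1 - ε)) x) := by
    rw [sqrt_pos, hPeq]
    apply mul_pos <;> linarith
  have hv : √((1 - x ^ 2) * sinSqPoly α (α ^ 2 * (1 - ε)) x) ≤ 2 * (ε + 2 * (1 - x)) := by
    rw [sqrt_le_left (by linarith), hPeq]
    calc _ ≤ (ε + 2 * (1 - x)) * ((ε + 2 * (1 - x)) * 4) := by
          gcongr <;> nlinarith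
      _ = _ := by ring
  have hv0 : α * (1 - x ^ 2) ≤ √((1 - x ^ 2) * sinSqPoly α (α ^ 2 * (1 - ε)) x) := by
    apply le_sqrt_of_sq_le
    rw [hPeq]
    calc _ = (1 - x ^ 2) * ((1 - x ^ 2) * α ^ 2) := by ring
      _ ≤ _ := by gcongr; linarith
  have hDeq : α ^ 2 * (1 - ε) * (1 - α ^ 2 * (1 - ε)) / α ^ 2 =
      (1 - ε) * (1 - α ^ 2 * (1 - ε)) := by
    field_simp
  have hD0 : 0 ≤ (1 - ε) * (1 - α ^ 2 * (1 - ε)) := mul_nonneg (by linarith) (by linarith)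
  rw [sinSqIntegrand, hDeq]
  generalize √((1 - x ^ 2) * sinSqPoly α (α ^ 2 * (1 - ε)) x) = v at *
  generalize √(sinSqPoly α (α ^ 2 * (1 - ε)) x) = r at *
  have hvpos : 0 < v := lt_of_lt_of_le (by positivity) hv0
  have hu : 0 < ε + 2 * (1 - x) := by linarith
  have hnum : α * (1 / 2) - 2 * α * (1 - x ^ 2) ≤
      2 * α * ((1 - ε) * (1 - α ^ 2 * (1 - ε))) * x ^ 2 - α * (1 - 2 * (α ^ 2 * (1 - ε)))
        + (1 - ε) * (1 - α ^ 2 * (1 - ε)) * x ^ 2 * r := by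
    have h1 : 0 ≤ (1 - ε) * (1 - α ^ 2 * (1 - ε)) * x ^ 2 * r := by positivity
    have h2 : 0 ≤ α ^ 2 * ((1 - ε) * ε) := mul_nonneg hα0.le (mul_nonneg (by linarith) hε.le)
    have h3 : (1 - ε) * (1 - α ^ 2 * (1 - ε)) ≤ 1 := by nlinarith
    have h4 := mul_nonneg (sub_nonneg.2 h3) hx'.le
    have h5 : 1 / 2 - 2 * (1 - x ^ 2) ≤
        2 * ((1 - ε) * (1 - α ^ 2 * (1 - ε))) * x ^ 2 - (1 - 2 * (α ^ 2 * (1 - ε))) := by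
      nlinarith
    nlinarith [mul_le_mul_of_nonneg_left h5 hα.le]
  calc _ = α * (1 / 2) / (2 * (ε + 2 * (1 - x)) * (α + 2)) - 2 / α := by
        field_simp
        norm_num
    _ ≤ α * (1 / 2) / (v * (α + r)) - 2 * α * (1 - x ^ 2) / (v * (α + r)) := by
        have h1 : α * (1 / 2) / (2 * (ε + 2 * (1 - x)) * (α + 2)) ≤
            α * (1 / 2) / (v * (α + r)) := by gcongr
        have h2 : 2 * α * (1 - x ^ 2) / (v * (α + r)) ≤ 2 / α := by
          rw [div_le_div_iff₀ (by positivity) hα]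
          nlinarith [mul_pos hvpos hr0, mul_le_mul_of_nonneg_left hv0 hα.le]
        linarith
    _ = (α * (1 / 2) - 2 * α * (1 - x ^ 2)) / (v * (α + r)) := by ring
    _ ≤ _ := by gcongr

theorem le_integral_sinSqIntegrand {ε : ℝ} (hα : 0 < α) (hα2 : α ^ 2 ≤ 1 / 2) (hε : 0 < ε)
    (hε1 : ε ≤ 1 / 4) :
    α / (4 * (α + 2)) * ((1 / 2) * log ((ε + 4) / ε)) - 4 / α ≤
      ∫ x in (-1 : ℝ)..1, sinSqIntegrand α (α ^ 2 * (1 - ε)) x := by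
  have hα0 : 0 < α ^ 2 := by positivity
  have hne : ∀ x ∈ Set.uIcc (-1 : ℝ) 1, ε + 2 * (1 - x) ≠ 0 := by
    intro x hx
    rw [Set.uIcc_of_le (by norm_num)] at hx
    linarith [hx.2]
  have hint : IntervalIntegrable (fun x => (ε + 2 * (1 - x))⁻¹) MeasureTheory.volume (-1) 1 :=
    (ContinuousOn.inv₀ (by fun_prop) hne).intervalIntegrable
  have heval : ∫ x in (-1 : ℝ)..1, (ε + 2 * (1 - x))⁻¹ = (1 / 2) * log ((ε + 4) / ε) := by
    have hd : ∀ x ∈ Set.uIcc (-1 : ℝ) 1,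
        HasDerivAt (fun x => -(1 / 2) * log (ε + 2 * (1 - x))) ((ε + 2 * (1 - x))⁻¹) x := by
      intro x hx
      have h1 : HasDerivAt (fun x : ℝ => ε + 2 * (1 - x)) (2 * (-1)) x :=
        (((hasDerivAt_id x).const_sub 1).const_mul 2).const_add ε
      refine ((h1.log (hne x hx)).const_mul (-(1 / 2))).congr_deriv ?_
      ring
    rw [intervalIntegral.integral_eq_sub_of_hasDerivAt hd hint, log_div (by positivity) hε.ne']
    norm_num
    ring
  have hi := intervalIntegrable_sinSqIntegrand (t := α ^ 2 * (1 - ε)) hα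
    (mul_nonneg hα0.le (by linarith)) (by nlinarith) (by nlinarith)
  have hl := (hint.const_mul (α / (4 * (α + 2)))).sub
    (intervalIntegrable_const (c := 2 / α) (μ := MeasureTheory.volume))
  have h := intervalIntegral.integral_mono_on_of_le_Ioo (by norm_num) hl hi
    fun x hx => le_sinSqIntegrand hα hα2 hε hε1 hx
  rw [intervalIntegral.integral_sub (hint.const_mul _) intervalIntegrable_const,
    intervalIntegral.integral_const_mul, heval, intervalIntegral.integral_const] at h
  convert h using 2
  simp only [smul_eq_mul]
  ring

theorem exists_integral_sinSqIntegrand_pos (hα : 0 < α) :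
    ∃ t, 0 < t ∧ t ≤ 1 / 2 ∧ t < α ^ 2 ∧ 0 < ∫ x in (-1 : ℝ)..1, sinSqIntegrand α t x := by
  rcases lt_or_ge (1 / 2) (α ^ 2) with h | h
  · exact ⟨1 / 2, by norm_num, le_rfl, h, integral_sinSqIntegrand_half_pos hα h⟩
  have hα0 : 0 < α ^ 2 := by positivity
  obtain ⟨B, hB⟩ : ∃ B, α / (4 * (α + 2)) * ((1 / 2) * B) - 4 / α = 1 :=
    ⟨(1 + 4 / α) * (2 * (4 * (α + 2)) / α), by field_simp; ring⟩
  have hk : 0 < α / (4 * (α + 2)) := by positivity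
  have hε1 : min (1 / 4) (exp (-B)) ≤ 1 / 4 := min_le_left _ _
  have hε : 0 < min (1 / 4) (exp (-B)) := lt_min (by norm_num) (exp_pos _)
  have hεB : min (1 / 4) (exp (-B)) ≤ exp (-B) := min_le_right _ _
  generalize min (1 / 4) (exp (-B)) = ε at *
  have hlog : B ≤ log ((ε + 4) / ε) := by
    rw [le_log_iff_exp_le (by positivity), le_div_iff₀ hε]
    calc exp B * ε ≤ exp B * exp (-B) := by gcongr
      _ = 1 := by rw [← exp_add]; simp
      _ ≤ _ := by linarith
  refine ⟨α ^ 2 * (1 - ε), mul_pos hα0 (by linarith), by nlinarith, by nlinarith, ?_⟩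
  have := le_integral_sinSqIntegrand hα h hε hε1
  have : α / (4 * (α + 2)) * ((1 / 2) * B) ≤
      α / (4 * (α + 2)) * ((1 / 2) * log ((ε + 4) / ε)) := by gcongr
  linarith

theorem lt_thetaPlus_iff {θ : ℝ} (hα : 0 < α) (h0 : 0 < θ) (h1 : θ < π / 4) :
    θ < thetaPlus α ↔ sin θ ^ 2 < α ^ 2 := by
  have hcos : cos (2 * θ) = 1 - 2 * sin θ ^ 2 := by rw [cos_two_mul, cos_sq']; ring
  unfold thetaPlus
  split_ifs with h
  · exact iff_of_true (by linarith) (by nlinarith [sin_sq_le_one θ])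
  · have hα1 : α ^ 2 ≤ 1 := by nlinarith
    rw [show θ < 1 / 2 * arccos (1 - 2 * α ^ 2) ↔ 2 * θ < arccos (1 - 2 * α ^ 2) by
      constructor <;> intro _ <;> linarith]
    rw [← strictAntiOn_cos.lt_iff_gt (a := arccos (1 - 2 * α ^ 2)) (b := 2 * θ)
      ⟨arccos_nonneg _, arccos_le_pi _⟩ ⟨by linarith, by linarith⟩,
      cos_arccos (by nlinarith) (by nlinarith), hcos]
    constructor <;> intro _ <;> linarith

theorem sin_sq_lt_half {θ : ℝ} (h0 : 0 < θ) (h1 : θ < π / 4) : sin θ ^ 2 < 1 / 2 := by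
  have hcos : cos (2 * θ) = 1 - 2 * sin θ ^ 2 := by rw [cos_two_mul, cos_sq']; ring
  have := cos_pos_of_mem_Ioo (x := 2 * θ) ⟨by linarith, by linarith⟩
  linarith

end

/-- For every `α > 0` there is a unique `θ̃ ∈ (0, θ⁺_α) ∩ (0, π/4)` with `L(α, θ̃) = 0`. -/
theorem statement_9 {α : ℝ} (hα : 0 < α) :
    ∃! θ : ℝ, θ ∈ Set.Ioo 0 (thetaPlus α) ∩ Set.Ioo 0 (Real.pi / 4) ∧ Lint α θ = 0 := by
  refine existsUnique_of_exists_of_unique ?_ ?_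
  · obtain ⟨t₁, h0, h1, h2, hpos⟩ := exists_integral_sinSqIntegrand_pos hα
    obtain ⟨t, ⟨ht0, ht1⟩, ht⟩ := intermediate_value_Ioo h0.le
      (continuousOn_integral_sinSqIntegrand hα h1 h2)
      ⟨integral_sinSqIntegrand_zero_neg hα, hpos⟩
    have hsin : sin (arcsin √t) ^ 2 = t := by
      rw [sin_arcsin (by linarith [sqrt_nonneg t]) (sqrt_le_one.2 (by linarith)), sq_sqrt ht0.le]
    have hpos' : 0 < arcsin √t := arcsin_pos.2 (sqrt_pos.2 ht0)
    have hlt : arcsin √t < π / 4 := by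
      rw [arcsin_lt_iff_lt_sin' ⟨by linarith [pi_pos], by linarith [pi_pos]⟩, sin_pi_div_four,
        sqrt_lt' (by positivity), div_pow, sq_sqrt (by norm_num)]
      linarith
    refine ⟨arcsin √t, ⟨⟨hpos', ?_⟩, hpos', hlt⟩, ?_⟩
    · rw [lt_thetaPlus_iff hα hpos' hlt, hsin]
      linarith
    · rw [Lint_eq_integral_sinSqIntegrand, hsin]
      exact ht
  · rintro θ θ' ⟨⟨⟨h0, hp⟩, -, h1⟩, h⟩ ⟨⟨⟨h0', hp'⟩, -, h1'⟩, h'⟩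
    rw [lt_thetaPlus_iff hα h0 h1] at hp
    rw [lt_thetaPlus_iff hα h0' h1'] at hp'
    rw [Lint_eq_integral_sinSqIntegrand] at h h'
    have hs : sin θ ^ 2 = sin θ' ^ 2 := by
      rcases lt_trichotomy (sin θ ^ 2) (sin θ' ^ 2) with hlt | heq | hlt
      · linarith [integral_sinSqIntegrand_lt hα (sq_nonneg _) hlt (sin_sq_lt_half h0' h1').le hp']
      · exact heq
      · linarith [integral_sinSqIntegrand_lt hα (sq_nonneg _) hlt (sin_sq_lt_half h0 h1).le hp]
    rw [sq_eq_sq₀ (sin_nonneg_of_mem_Icc ⟨h0.le, by linarith [pi_pos]⟩)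
      (sin_nonneg_of_mem_Icc ⟨h0'.le, by linarith [pi_pos]⟩)] at hs
    exact injOn_sin ⟨by linarith, by linarith⟩ ⟨by linarith, by linarith⟩ hs
end

section
/- Let α > 0, let θ = θ̃_α be the unique zero of L(α,·) in (0, θ⁺_α) ∩ (0, π/4), let φ, β, G, U be as in the context, and fix c ∈ ℝ. Define the curve γ : ℝ → ℝ², γ(u) = (y₁(u), y₃(u)), with y₁, y₃ as in the context. Then γ(u+2U) = γ(u) and γ(u+U) = −γ(u) for all u, γ is injective on [0, 2U), and the image of γ is the frontier of a compact convex subset of ℝ²; that is, the intersection of the horizontal catenoid with each vertical plane y₂ = c is a nonempty closed embedded convex curve. -/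
open Real Filter

/-- A smooth centrally symmetric curve whose tangent angle `ψ` increases by `π` over each half-period
is simple, and it bounds a compact convex set. -/
theorem injOn_and_range_eq_frontier_of_strictMono_angle {X Y ρ ψ ψ' : ℝ → ℝ} {U : ℝ} (hU : 0 < U)
    (hX : ∀ u, HasDerivAt X (ρ u * cos (ψ u)) u) (hY : ∀ u, HasDerivAt Y (ρ u * sin (ψ u)) u)
    (hρ : ∀ u, 0 < ρ u) (hψ : ∀ u, HasDerivAt ψ (ψ' u) u) (hψ' : ∀ u, 0 < ψ' u)
    (hψU : ∀ u, ψ (u + U) = ψ u + π)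
    (hXU : ∀ u, X (u + U) = -X u) (hYU : ∀ u, Y (u + U) = -Y u) :
    Set.InjOn (fun u => (X u, Y u)) (Set.Ico 0 (2 * U)) ∧
    ∃ K : Set (ℝ × ℝ), IsCompact K ∧ Convex ℝ K ∧
      Set.range (fun u => (X u, Y u)) = frontier K := by
  have hmono : StrictMono ψ := strictMono_of_hasDerivAt_pos hψ hψ'
  have hψc : Continuous ψ := continuous_iff_continuousAt.2 fun u => (hψ u).continuousAt
  have hXc : Continuous X := continuous_iff_continuousAt.2 fun u => (hX u).continuousAt
  have hYc : Continuous Y := continuous_iff_continuousAt.2 fun u => (hY u).continuousAt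
  have hXP : Function.Periodic X (2 * U) := fun u => by
    rw [two_mul, ← add_assoc, hXU, hXU, neg_neg]
  have hYP : Function.Periodic Y (2 * U) := fun u => by
    rw [two_mul, ← add_assoc, hYU, hYU, neg_neg]
  have hψP (u : ℝ) : ψ (u + 2 * U) = ψ u + 2 * π := by
    rw [two_mul, ← add_assoc, hψU, hψU]; ring
  let h : ℝ → ℝ → ℝ := fun v u => X u * sin (ψ v) - Y u * cos (ψ v)
  have hhd (v u : ℝ) : HasDerivAt (h v) (-(ρ u * sin (ψ u - ψ v))) u := by
    refine (((hX u).mul_const (sin (ψ v))).sub ((hY u).mul_const (cos (ψ v)))).congr_deriv ?_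
    rw [sin_sub]; ring
  have hhc (v : ℝ) : Continuous (h v) :=
    continuous_iff_continuousAt.2 fun u => (hhd v u).continuousAt
  have hhP (v : ℝ) : Function.Periodic (h v) (2 * U) := fun u => by
    simp only [h, hXP u, hYP u]
  have hanti (v : ℝ) : StrictAntiOn (h v) (Set.Icc v (v + U)) := by
    refine strictAntiOn_of_deriv_neg (convex_Icc _ _) (hhc v).continuousOn fun u hu => ?_
    rw [interior_Icc] at hu
    have h1 := hmono hu.1
    have h2 := hmono hu.2
    rw [hψU] at h2
    rw [(hhd v u).deriv, neg_lt_zero]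
    exact mul_pos (hρ u) (sin_pos_of_pos_of_lt_pi (by linarith) (by linarith))
  have hincr (v : ℝ) : StrictMonoOn (h v) (Set.Icc (v - U) v) := by
    refine strictMonoOn_of_deriv_pos (convex_Icc _ _) (hhc v).continuousOn fun u hu => ?_
    rw [interior_Icc] at hu
    have h1 := hmono hu.1
    have h2 := hmono hu.2
    have h3 := hψU (v - U)
    rw [sub_add_cancel] at h3
    rw [(hhd v u).deriv, ← mul_neg, ← sin_neg]
    exact mul_pos (hρ u) (sin_pos_of_pos_of_lt_pi (by linarith) (by linarith))
  have hlt (v u : ℝ) (hvu : v < u) (huv : u < v + 2 * U) : h v u < h v v := by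
    rcases le_or_gt u (v + U) with hle | hgt
    · exact hanti v ⟨le_rfl, by linarith⟩ ⟨hvu.le, hle⟩ hvu
    · rw [← (hhP v).sub_eq u]
      exact hincr v ⟨by linarith, by linarith⟩ ⟨by linarith, le_rfl⟩ (by linarith)
  have hle (v u : ℝ) : h v u ≤ h v v := by
    obtain ⟨w, hw, hw'⟩ := (hhP v).exists_mem_Ico (by linarith : 0 < 2 * U) u v
    rw [hw']
    rcases hw.1.eq_or_lt with rfl | hvw
    · exact le_rfl
    · exact (hlt v w hvw hw.2).le
  refine ⟨?_, ?_⟩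
  · have key (u v : ℝ) (hu : 0 ≤ u) (huv : u < v) (hv : v < 2 * U) :
        (X u, Y u) ≠ (X v, Y v) := by
      intro heq
      obtain ⟨hx, hy⟩ := Prod.mk.inj heq
      have := hlt u v huv (by linarith)
      simp only [h, hx, hy, lt_irrefl] at this
    intro u hu v hv heq
    rcases lt_trichotomy u v with huv | huv | huv
    · exact absurd heq (key u v hu.1 huv hv.2)
    · exact huv
    · exact absurd heq.symm (key v u hv.1 huv hu.2)
  let F : ℝ × ℝ → ℝ → ℝ := fun q u => q.1 * sin (ψ u) - q.2 * cos (ψ u) - h u u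
  have hFP (q : ℝ × ℝ) : Function.Periodic (F q) (2 * U) := fun u => by
    simp only [F, h, hXP u, hYP u, hψP, sin_add_two_pi, cos_add_two_pi]
  have hFc : Continuous fun z : (ℝ × ℝ) × ℝ => F z.1 z.2 := by
    simp only [F, h]
    fun_prop
  have hFd (q : ℝ × ℝ) (u : ℝ) : HasDerivAt (F q)
      (ψ' u * ((q.1 - X u) * cos (ψ u) + (q.2 - Y u) * sin (ψ u))) u := by
    refine ((((hψ u).sin.const_mul q.1).sub ((hψ u).cos.const_mul q.2)).sub
      (((hX u).mul (hψ u).sin).sub ((hY u).mul (hψ u).cos))).congr_deriv ?_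
    ring
  let K : Set (ℝ × ℝ) := {q | ∀ u, F q u ≤ 0}
  have hKclosed : IsClosed K := by
    simp only [K, Set.ofPred_forall]
    refine isClosed_iInter fun u => isClosed_le ?_ continuous_const
    exact hFc.comp (by fun_prop : Continuous fun q : ℝ × ℝ => (q, u))
  have hsurj (t : ℝ) (ht : ψ 0 ≤ t) (ht' : t ≤ ψ 0 + 2 * π) : ∃ u, ψ u = t := by
    have := intermediate_value_Icc (by linarith : (0 : ℝ) ≤ 2 * U) hψc.continuousOn
    have hP := hψP 0
    rw [zero_add] at hP
    obtain ⟨u, -, hu⟩ := this ⟨ht, by rw [hP]; exact ht'⟩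
    exact ⟨u, hu⟩
  have hbdd : Bornology.IsBounded K := by
    obtain ⟨v, hv⟩ := hsurj (ψ 0 + π / 2) (by linarith [pi_pos]) (by linarith [pi_pos])
    have hb (q : ℝ × ℝ) (hq : q ∈ K) (u : ℝ) :
        |q.1 * sin (ψ u) - q.2 * cos (ψ u)| ≤ h u u := by
      have h1 := hq u
      have h2 := hq (u + U)
      simp only [F, h, hψU, hXU, hYU, sin_add_pi, cos_add_pi] at h1 h2 ⊢
      rw [abs_le]
      constructor <;> linarith
    refine (Metric.isBounded_iff_subset_closedBall 0).2 ⟨h 0 0 + h v v, fun q hq => ?_⟩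
    have h1 := hb q hq 0
    have h2 := hb q hq v
    rw [hv, sin_add_pi_div_two, cos_add_pi_div_two] at h2
    set s := sin (ψ 0)
    set k := cos (ψ 0)
    have hsk : s ^ 2 + k ^ 2 = 1 := sin_sq_add_cos_sq _
    have hs : |s| ≤ 1 := abs_sin_le_one _
    have hk : |k| ≤ 1 := abs_cos_le_one _
    have hmul (a b : ℝ) (hb : |b| ≤ 1) : |a * b| ≤ |a| := by
      rw [abs_mul]
      exact mul_le_of_le_one_right (abs_nonneg a) hb
    have e1 : q.1 = (q.1 * s - q.2 * k) * s + (q.1 * k - q.2 * -s) * k := by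
      linear_combination (-q.1) * hsk
    have e2 : q.2 = (q.1 * k - q.2 * -s) * s - (q.1 * s - q.2 * k) * k := by
      linear_combination (-q.2) * hsk
    rw [mem_closedBall_zero_iff, Prod.norm_def, Real.norm_eq_abs, Real.norm_eq_abs]
    refine max_le ?_ ?_
    · rw [e1]
      refine (abs_add_le _ _).trans ?_
      exact add_le_add ((hmul _ _ hs).trans h1) ((hmul _ _ hk).trans h2)
    · rw [e2]
      refine (abs_sub _ _).trans ?_
      rw [add_comm]
      exact add_le_add ((hmul _ _ hk).trans h1) ((hmul _ _ hs).trans h2)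
  refine ⟨K, Metric.isCompact_of_isClosed_isBounded hKclosed hbdd, ?_, ?_⟩
  · intro p hp q hq a b ha hb hab u
    have h1 := mul_le_mul_of_nonneg_left (hp u) ha
    have h2 := mul_le_mul_of_nonneg_left (hq u) hb
    have h3 : F (a • p + b • q) u = a * F p u + b * F q u := by
      simp only [F, Prod.fst_add, Prod.snd_add, Prod.smul_fst, Prod.smul_snd, smul_eq_mul]
      linear_combination h u u * hab
    linarith
  · have hpos : ∀ q : ℝ × ℝ, (∀ u, F q u < 0) → q ∈ interior K := by
      intro q hq
      rw [mem_interior_iff_mem_nhds]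
      have hev : ∀ᶠ r in nhds q, ∀ u ∈ Set.Icc 0 (2 * U), F r u < 0 := by
        refine isCompact_Icc.eventually_forall_of_forall_eventually fun u _ => ?_
        exact hFc.continuousAt.eventually_lt continuousAt_const (hq u)
      filter_upwards [hev] with r hr u
      obtain ⟨w, hw, hw'⟩ := (hFP r).exists_mem_Ico₀ (by linarith : 0 < 2 * U) u
      rw [hw']
      exact (hr w ⟨hw.1, hw.2.le⟩).le
    apply Set.Subset.antisymm
    · rintro _ ⟨u, rfl⟩
      rw [hKclosed.frontier_eq]
      refine ⟨fun v => sub_nonpos.2 (hle v u), fun hint => ?_⟩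
      have hlim : Tendsto (fun t : ℝ => (X u + t * sin (ψ u), Y u - t * cos (ψ u)))
          (nhdsWithin 0 (Set.Ioi 0)) (nhds (X u, Y u)) := by
        have : Continuous fun t : ℝ => (X u + t * sin (ψ u), Y u - t * cos (ψ u)) := by fun_prop
        simpa using (this.tendsto 0).mono_left nhdsWithin_le_nhds
      obtain ⟨t, htK, ht⟩ := ((hlim.eventually (mem_interior_iff_mem_nhds.1 hint)).and
        self_mem_nhdsWithin).exists
      have h1 := htK u
      have ht : 0 < t := ht
      have h2 : F (X u + t * sin (ψ u), Y u - t * cos (ψ u)) u = t := by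
        simp only [F, h]
        linear_combination t * sin_sq_add_cos_sq (ψ u)
      linarith
    · intro q hq
      rw [hKclosed.frontier_eq] at hq
      obtain ⟨hqK, hqi⟩ := hq
      have : ∃ u, 0 ≤ F q u := by
        by_contra! hne
        exact hqi (hpos q hne)
      obtain ⟨u, hu⟩ := this
      have h0 : F q u = 0 := le_antisymm (hqK u) hu
      have hmax : IsLocalMax (F q) u := Eventually.of_forall fun v => by
        rw [h0]
        exact hqK v
      have h1 := (mul_eq_zero.1 (hmax.hasDerivAt_eq_zero (hFd q u))).resolve_left (hψ' u).ne'
      simp only [F, h] at h0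
      have hsc := sin_sq_add_cos_sq (ψ u)
      refine ⟨u, Prod.ext ?_ ?_⟩
      · linear_combination (-cos (ψ u)) * h1 - sin (ψ u) * h0 + (q.1 - X u) * hsc
      · linear_combination (-sin (ψ u)) * h1 + cos (ψ u) * h0 + (q.2 - Y u) * hsc

theorem Ppoly_pos_s14 {α θ x : ℝ} (hα : 0 < α) (hθ₀ : 0 < θ) (hθ : θ < thetaPlus α)
    (hθ' : θ < π / 4) (hx : x ^ 2 ≤ 1) : 0 < Ppoly α θ x := by
  have hk : 0 < cos (2 * θ) := cos_pos_of_mem_Ioo ⟨by linarith, by linarith⟩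
  have hk' : 1 < 2 * α ^ 2 + cos (2 * θ) := by
    unfold thetaPlus at hθ
    split_ifs at hθ with h
    · nlinarith
    · push Not at h
      have h1 : cos (arccos (1 - 2 * α ^ 2)) < cos (2 * θ) :=
        cos_lt_cos_of_nonneg_of_le_pi (by linarith) (arccos_le_pi _) (by linarith)
      rw [cos_arccos (by nlinarith) (by nlinarith)] at h1
      linarith
  have hC : 4 * α ^ 2 * Ccoef α θ ^ 2 = 1 - cos (2 * θ) ^ 2 := by
    unfold Ccoef
    rw [← sin_sq]
    field_simp
    ring
  have hP1 : 0 < α ^ 2 + cos (2 * θ) - Ccoef α θ ^ 2 := by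
    have : 0 < 4 * α ^ 2 * (α ^ 2 + cos (2 * θ) - Ccoef α θ ^ 2) := by nlinarith
    exact pos_of_mul_pos_right this (by positivity)
  unfold Ppoly
  have hx4 : x ^ 4 ≤ x ^ 2 := by nlinarith [sq_nonneg x]
  have h1 : Ccoef α θ ^ 2 * x ^ 4 ≤ Ccoef α θ ^ 2 * x ^ 2 :=
    mul_le_mul_of_nonneg_left hx4 (sq_nonneg _)
  have h2 : 0 ≤ (α ^ 2 + cos (2 * θ) - Ccoef α θ ^ 2) * x ^ 2 := by positivity
  rcases hx.eq_or_lt with h3 | h3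
  · rw [show x ^ 4 = (x ^ 2) ^ 2 by ring, h3]
    linarith
  · have : 0 < α ^ 2 * (1 - x ^ 2) := mul_pos (by positivity) (by linarith)
    linarith

/-- The substitution `x = cos φ(u)` turns `Lint` into an integral over a half-period of `φ`. -/
theorem Lint_eq_integral {α θ U : ℝ} {φ φ' : ℝ → ℝ} (hU : 0 < U)
    (hφ : ∀ u, HasDerivAt φ (φ' u) u)
    (hφ' : ∀ u, φ' u = -√(Ppoly α θ (cos (φ u)))) (hP : ∀ u, 0 < Ppoly α θ (cos (φ u)))
    (hφ0 : φ 0 = 0) (hφU : φ U = -π) :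
    Lint α θ = ∫ u in (0 : ℝ)..U,
      (2 * α * Ccoef α θ ^ 2 * cos (φ u) ^ 2 - α * cos (2 * θ)
        + Ccoef α θ ^ 2 * cos (φ u) ^ 2 * √(Ppoly α θ (cos (φ u)))) /
      (α + √(Ppoly α θ (cos (φ u)))) := by
  have hφc : Continuous φ := continuous_iff_continuousAt.2 fun u => (hφ u).continuousAt
  have hanti : StrictAnti φ := strictAnti_of_hasDerivAt_neg hφ fun u => by
    rw [hφ', neg_lt_zero]
    exact sqrt_pos.2 (hP u)
  have hmem {u : ℝ} (hu : u ∈ Set.Ioo 0 U) : φ u ∈ Set.Ioo (-π) 0 := by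
    constructor
    · rw [← hφU]
      exact hanti hu.2
    · rw [← hφ0]
      exact hanti hu.1
  have himage : (fun u => cos (φ u)) '' Set.Ioo 0 U = Set.Ioo (-1) 1 := by
    ext x
    constructor
    · rintro ⟨u, hu, rfl⟩
      have h := hmem hu
      have hs := sin_neg_of_neg_of_neg_pi_lt h.2 h.1
      have := sin_sq_add_cos_sq (φ u)
      constructor <;> nlinarith
    · intro hx
      have h0 : 0 < arccos x := arccos_pos.2 hx.2
      have h1 : arccos x < π := by
        refine lt_of_le_of_ne (arccos_le_pi x) fun h => ?_
        exact absurd (arccos_eq_pi.1 h) (not_le.2 hx.1)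
      have := intermediate_value_Ioo' hU.le hφc.continuousOn
      rw [hφ0, hφU] at this
      obtain ⟨u, hu, hu'⟩ := this (show -arccos x ∈ Set.Ioo (-π) 0 from ⟨by linarith, by linarith⟩)
      exact ⟨u, hu, by simp only [hu', cos_neg, cos_arccos hx.1.le hx.2.le]⟩
  have hinj : Set.InjOn (fun u => cos (φ u)) (Set.Ioo 0 U) := by
    intro u hu v hv h
    have hu' := hmem hu
    have hv' := hmem hv
    have : -φ u = -φ v := injOn_cos ⟨by linarith [hu'.2], by linarith [hu'.1]⟩
      ⟨by linarith [hv'.2], by linarith [hv'.1]⟩ (by simpa only [cos_neg] using h)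
    exact hanti.injective (neg_injective this)
  rw [Lint, intervalIntegral.integral_of_le (by norm_num), intervalIntegral.integral_of_le hU.le,
    MeasureTheory.integral_Ioc_eq_integral_Ioo, MeasureTheory.integral_Ioc_eq_integral_Ioo,
    ← himage, MeasureTheory.integral_image_eq_integral_abs_deriv_smul measurableSet_Ioo
      (fun u _ => (hφ u).cos.hasDerivWithinAt) hinj]
  refine MeasureTheory.setIntegral_congr_fun measurableSet_Ioo fun u hu => ?_
  have h := hmem hu
  have hs := sin_neg_of_neg_of_neg_pi_lt h.2 h.1
  have hr := sqrt_pos.2 (hP u)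
  have h1 : √((1 - cos (φ u) ^ 2) * Ppoly α θ (cos (φ u)))
      = -sin (φ u) * √(Ppoly α θ (cos (φ u))) := by
    rw [← sin_sq, sqrt_mul (sq_nonneg _), sqrt_sq_eq_abs, abs_of_neg hs]
  have h2 : |-sin (φ u) * φ' u| = -sin (φ u) * √(Ppoly α θ (cos (φ u))) := by
    rw [hφ', mul_neg, abs_neg, abs_of_pos (mul_pos (neg_pos.2 hs) hr)]
  have h3 : -sin (φ u) * √(Ppoly α θ (cos (φ u))) ≠ 0 := (mul_pos (neg_pos.2 hs) hr).ne'
  simp only [h1, h2, smul_eq_mul]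
  rw [mul_div_assoc', mul_div_mul_left _ _ h3]

/-- The intersection of the horizontal catenoid with each vertical plane `y₂ = c` is a
nonempty closed embedded convex curve: `γ` is `2U`-periodic with `γ(u+U) = -γ(u)`,
injective on `[0, 2U)`, and its image is the frontier of a compact convex set. -/
theorem statement_14 {α θ : ℝ} (hα : 0 < α)
    (hθmem : θ ∈ Set.Ioo 0 (thetaPlus α) ∩ Set.Ioo 0 (Real.pi / 4))
    (hθzero : Lint α θ = 0)
    (φ φ' β G Gd : ℝ → ℝ)
    (hφ : ∀ u, HasDerivAt φ (φ' u) u) (hφ'c : Continuous φ')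
    (hode : ∀ u, (φ' u) ^ 2 = Ppoly α θ (Real.cos (φ u)))
    (hφ0 : φ 0 = 0) (hφ'0 : φ' 0 ≤ 0)
    (hβ : ∀ u, HasDerivAt β (Ccoef α θ * Real.cos (φ u) ^ 2) u) (hβ0 : β 0 = 0)
    (hGd : ∀ u, Gd u =
      (Ccoef α θ ^ 2 * Real.cos (φ u) ^ 2 - Real.cos (2 * θ)) / (α - φ' u))
    (hG : ∀ u, HasDerivAt G (Gd u) u) (hG0 : G 0 = 0)
    (U : ℝ) (hU : 0 < U) (hUper : ∀ u, φ (u + U) = φ u - Real.pi)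
    (c : ℝ) (Ac y₁ y₃ : ℝ → ℝ) (γ : ℝ → ℝ × ℝ)
    (hAc : ∀ u, Ac u = α / Ccoef α θ * c + β u + α / Ccoef α θ * G u)
    (hy₁ : ∀ u, y₁ u = Gd u / α * Real.cos (φ u) * Real.sinh (Ac u)
      - Ccoef α θ / α * Real.sin (φ u) * Real.cosh (Ac u))
    (hy₃ : ∀ u, y₃ u = Ccoef α θ / α * (Gd u / α - 1) * Real.cos (φ u) * Real.cosh (Ac u)
      - 1 / α * (Ccoef α θ ^ 2 / α + Gd u) * Real.sin (φ u) * Real.sinh (Ac u))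
    (hγ : ∀ u, γ u = (y₁ u, y₃ u)) :
    (∀ u, γ (u + 2 * U) = γ u) ∧ (∀ u, γ (u + U) = -γ u) ∧
    Set.InjOn γ (Set.Ico 0 (2 * U)) ∧
    ∃ K : Set (ℝ × ℝ), IsCompact K ∧ Convex ℝ K ∧ Set.range γ = frontier K := by
  obtain ⟨⟨hθ0, hθ1⟩, -, hθ2⟩ := hθmem
  have hC : 0 < Ccoef α θ := div_pos (sin_pos_of_pos_of_lt_pi (by linarith) (by linarith [pi_pos]))
    (by positivity)
  have hP (u : ℝ) : 0 < Ppoly α θ (cos (φ u)) := Ppoly_pos_s14 hα hθ0 hθ1 hθ2 (cos_sq_le_one _)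
  have hneg (u : ℝ) : φ' u < 0 := by
    by_contra! h
    obtain ⟨v, hv⟩ := mem_range_of_exists_le_of_exists_ge hφ'c ⟨0, hφ'0⟩ ⟨u, h⟩
    have := hode v
    rw [hv] at this
    linarith [hP v]
  have hsqrt (u : ℝ) : φ' u = -√(Ppoly α θ (cos (φ u))) := by
    rw [← hode, sqrt_sq_eq_abs, abs_of_neg (hneg u), neg_neg]
  have hD (u : ℝ) : α - φ' u ≠ 0 := by linarith [hneg u]
  have hcos (u : ℝ) : cos (φ (u + U)) = -cos (φ u) := by rw [hUper, cos_sub_pi]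
  have hsin (u : ℝ) : sin (φ (u + U)) = -sin (φ u) := by rw [hUper, sin_sub_pi]
  have hφ'U (u : ℝ) : φ' (u + U) = φ' u := by
    rw [hsqrt, hsqrt, hcos]
    simp only [Ppoly, Even.neg_pow (by decide : Even 4), neg_sq]
  have hGdU (u : ℝ) : Gd (u + U) = Gd u := by
    rw [hGd, hGd, hcos, hφ'U, neg_sq]
  have hφd2 (u : ℝ) : HasDerivAt φ'
      (-sin (φ u) * (cos (2 * θ) * cos (φ u) - 2 * Ccoef α θ ^ 2 * cos (φ u) ^ 3)) u := by
    have h1 : HasDerivAt (fun v => Ppoly α θ (cos (φ v)))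
        (2 * φ' u * (-sin (φ u) * (cos (2 * θ) * cos (φ u)
          - 2 * Ccoef α θ ^ 2 * cos (φ u) ^ 3))) u := by
      refine (((((hφ u).cos.pow 2).const_mul (cos (2 * θ))).const_add (α ^ 2)).sub
        (((hφ u).cos.pow 4).const_mul (Ccoef α θ ^ 2))).congr_deriv ?_
      push_cast
      ring
    have h2 := (h1.sqrt (hP u).ne').neg
    have h3 : φ' = fun v => -√(Ppoly α θ (cos (φ v))) := funext hsqrt
    rw [h3]
    refine h2.congr_deriv ?_
    have h4 := (hneg u).ne
    rw [← neg_eq_iff_eq_neg.2 (hsqrt u)]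
    field_simp
  have hquot (u : ℝ) : Gd u * (α - φ' u) = Ccoef α θ ^ 2 * cos (φ u) ^ 2 - cos (2 * θ) := by
    rw [hGd, div_mul_cancel₀ _ (hD u)]
  have hrel (u : ℝ) : cos (φ u) ^ 2 * Gd u = α + φ' u := by
    apply mul_right_cancel₀ (hD u)
    have := hode u
    rw [Ppoly] at this
    linear_combination cos (φ u) ^ 2 * hquot u + this
  have hGdd (u : ℝ) : HasDerivAt Gd
      (sin (φ u) * cos (φ u) * (Ccoef α θ ^ 2 + Gd u ^ 2)) u := by
    have h1 := ((((hφ u).cos.pow 2).const_mul (Ccoef α θ ^ 2)).sub_const (cos (2 * θ))).div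
      ((hφd2 u).const_sub α) (hD u)
    refine (h1.congr_of_eventuallyEq (.of_forall hGd)).congr_deriv ?_
    rw [div_eq_iff (pow_ne_zero 2 (hD u))]
    simp only [Pi.pow_apply]
    push_cast
    linear_combination
      (α - φ' u) * sin (φ u) * cos (φ u) * Ccoef α θ ^ 2 * hrel u
        - ((α - φ' u) * Gd u * sin (φ u) * cos (φ u)
          - sin (φ u) * (cos (2 * θ) * cos (φ u) - 2 * Ccoef α θ ^ 2 * cos (φ u) ^ 3)) * hquot u
  have hAd (u : ℝ) : HasDerivAt Ac
      (Ccoef α θ * cos (φ u) ^ 2 + α / Ccoef α θ * Gd u) u := by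
    rw [show Ac = fun u => α / Ccoef α θ * c + β u + α / Ccoef α θ * G u from funext hAc]
    exact ((hβ u).const_add _).add ((hG u).const_mul _)
  have hφc : Continuous φ := continuous_iff_continuousAt.2 fun u => (hφ u).continuousAt
  have hGdc : Continuous Gd := continuous_iff_continuousAt.2 fun u => (hGdd u).continuousAt
  have hAU0 : Ac U = Ac 0 := by
    have h1 := intervalIntegral.integral_eq_sub_of_hasDerivAt (a := 0) (b := U)
      (fun u _ => hAd u) (Continuous.intervalIntegrable (by fun_prop) _ _)
    have h2 := Lint_eq_integral hU hφ hsqrt hP hφ0 (by simpa [hφ0] using hUper 0)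
    rw [hθzero, show (0 : ℝ) = Ccoef α θ * 0 by simp] at h2
    have h3 : ∀ u, (2 * α * Ccoef α θ ^ 2 * cos (φ u) ^ 2 - α * cos (2 * θ)
        + Ccoef α θ ^ 2 * cos (φ u) ^ 2 * √(Ppoly α θ (cos (φ u)))) /
        (α + √(Ppoly α θ (cos (φ u))))
        = Ccoef α θ * (Ccoef α θ * cos (φ u) ^ 2 + α / Ccoef α θ * Gd u) := by
      intro u
      rw [← neg_eq_iff_eq_neg.2 (hsqrt u), ← sub_eq_add_neg, div_eq_iff (hD u)]
      field_simp
      linear_combination (-α) * hquot u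
    simp only [h3, mul_zero, intervalIntegral.integral_const_mul] at h2
    have h4 := (mul_eq_zero.1 h2.symm).resolve_left hC.ne'
    linarith
  have hAU (u : ℝ) : Ac (u + U) = Ac u := by
    have hd (v : ℝ) : HasDerivAt (fun w => Ac (w + U) - Ac w) 0 v := by
      refine (((hAd (v + U)).comp_add_const v U).sub (hAd v)).congr_deriv ?_
      rw [hcos, hGdU]
      ring
    have := is_const_of_deriv_eq_zero (fun v => (hd v).differentiableAt)
      (fun v => (hd v).deriv) u 0
    simp only [zero_add, hAU0, sub_self] at this
    linarith
  have hy₁U (u : ℝ) : y₁ (u + U) = -y₁ u := by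
    rw [hy₁, hy₁, hcos, hsin, hGdU, hAU]
    ring
  have hy₃U (u : ℝ) : y₃ (u + U) = -y₃ u := by
    rw [hy₃, hy₃, hcos, hsin, hGdU, hAU]
    ring
  have hy₁d (u : ℝ) : HasDerivAt y₁
      ((Ccoef α θ ^ 2 + Gd u ^ 2) * cosh (Ac u) / Ccoef α θ * cos (-φ u)) u := by
    rw [show y₁ = fun u => Gd u / α * cos (φ u) * sinh (Ac u)
      - Ccoef α θ / α * sin (φ u) * cosh (Ac u) from funext hy₁]
    refine (((((hGdd u).div_const α).mul (hφ u).cos).mul (hAd u).sinh).sub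
      (((hφ u).sin.const_mul (Ccoef α θ / α)).mul (hAd u).cosh)).congr_deriv ?_
    rw [cos_neg]
    have h1 := hrel u
    simp only [Pi.mul_apply]
    generalize cos (φ u) = x at *
    generalize sin (φ u) = s at *
    generalize Gd u = g at *
    generalize φ' u = p at *
    generalize Ccoef α θ = C at *
    field_simp
    linear_combination (sinh (Ac u) * s * g * C + cosh (Ac u) * x * C ^ 2) * h1
  have hy₃d (u : ℝ) : HasDerivAt y₃
      ((Ccoef α θ ^ 2 + Gd u ^ 2) * cosh (Ac u) / Ccoef α θ * sin (-φ u)) u := by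
    rw [show y₃ = fun u => Ccoef α θ / α * (Gd u / α - 1) * cos (φ u) * cosh (Ac u)
      - 1 / α * (Ccoef α θ ^ 2 / α + Gd u) * sin (φ u) * sinh (Ac u) from funext hy₃]
    refine (((((((hGdd u).div_const α).sub_const 1).const_mul (Ccoef α θ / α)).mul
      (hφ u).cos).mul (hAd u).cosh).sub
      (((((hGdd u).const_add (Ccoef α θ ^ 2 / α)).const_mul (1 / α)).mul
        (hφ u).sin).mul (hAd u).sinh)).congr_deriv ?_
    rw [sin_neg]
    have h1 := hrel u
    have h2 := sin_sq_add_cos_sq (φ u)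
    simp only [Pi.mul_apply]
    generalize cos (φ u) = x at *
    generalize sin (φ u) = s at *
    generalize Gd u = g at *
    generalize φ' u = p at *
    generalize Ccoef α θ = C at *
    field_simp
    linear_combination (sinh (Ac u) * x * C * (C ^ 2 + g * α)
      + cosh (Ac u) * s * C ^ 2 * (g - α)) * h1
      - sinh (Ac u) * x * α * C * (C ^ 2 + g ^ 2) * h2
  have hγU (u : ℝ) : γ (u + U) = -γ u := by
    rw [hγ, hγ, hy₁U, hy₃U, Prod.neg_mk]
  refine ⟨fun u => by rw [two_mul, ← add_assoc, hγU, hγU, neg_neg], hγU, ?_⟩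
  rw [show γ = fun u => (y₁ u, y₃ u) from funext hγ]
  exact injOn_and_range_eq_frontier_of_strictMono_angle hU hy₁d hy₃d
    (fun u => div_pos (mul_pos (by positivity) (cosh_pos _)) hC) (fun u => (hφ u).neg)
    (fun u => neg_pos.2 (hneg u)) (fun u => by rw [hUper]; ring) hy₁U hy₃U
end

section
/- For each α > 0 let θ̃_α, C_α, φ_α, β_α, G_α be as in the context, and define on the curve y₂ = 0: A_α(u) = β_α(u) + (α/C_α)·G_α(u), y₁^α(u) = (G_α'(u)/α)·cos φ_α(u)·sinh A_α(u) − (C_α/α)·sin φ_α(u)·cosh A_α(u), and y₃^α(u) = (C_α/α)·(G_α'(u)/α − 1)·cos φ_α(u)·cosh A_α(u) − (1/α)·(C_α²/α + G_α'(u))·sin φ_α(u)·sinh A_α(u). Then sup_{u∈ℝ} (|y₁^α(u)| + |y₃^α(u)|) → 0 as α → +∞; that is, the curve of equation y₂ = 0 on the horizontal catenoid converges uniformly to the origin. -/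
open Real Filter

/-- The primitive vanishing at `0` of a periodic function with mean zero is bounded. -/
lemma abs_integral_le_of_periodic_of_integral_eq_zero {h : ℝ → ℝ} {T B : ℝ} (hT : 0 < T)
    (hc : Continuous h) (hp : Function.Periodic h T) (h0 : ∫ t in (0 : ℝ)..T, h t = 0)
    (hB : ∀ t, |h t| ≤ B) (t : ℝ) : |∫ τ in (0 : ℝ)..t, h τ| ≤ B * T := by
  have hii : ∀ a b : ℝ, IntervalIntegrable h MeasureTheory.volume a b :=
    fun a b => hc.intervalIntegrable a b
  have hper : Function.Periodic (fun t => ∫ τ in (0 : ℝ)..t, h τ) T := by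
    intro s
    have h1 := intervalIntegral.integral_add_adjacent_intervals (hii 0 s) (hii s (s + T))
    have h2 := hp.intervalIntegral_add_eq s 0
    rw [zero_add] at h2
    simp only
    linarith
  obtain ⟨s, hs, hts⟩ := hper.exists_mem_Ico₀ hT t
  rw [hts]
  have hB0 : 0 ≤ B := (abs_nonneg _).trans (hB 0)
  have h3 : ‖∫ τ in (0 : ℝ)..s, h τ‖ ≤ B * |s - 0| :=
    intervalIntegral.norm_integral_le_of_norm_le_const fun x _ => hB x
  rw [Real.norm_eq_abs, sub_zero, abs_of_nonneg hs.1] at h3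
  exact h3.trans (mul_le_mul_of_nonneg_left hs.2.le hB0)

lemma Ccoef_sq_le {α θ : ℝ} (hα : 1 ≤ α) : Ccoef α θ ^ 2 ≤ 1 / 4 := by
  have h1 : Real.sin (2 * θ) ^ 2 ≤ 1 := Real.sin_sq_le_one _
  rw [Ccoef, div_pow, div_le_div_iff₀ (by positivity) (by norm_num)]
  nlinarith

lemma sqrt_Ppoly_bounds {α θ x : ℝ} (hα : 1 ≤ α) (hc : 0 ≤ Real.cos (2 * θ))
    (hx : x ^ 2 ≤ 1) :
    0 < Ppoly α θ x ∧ α / 2 ≤ √(Ppoly α θ x) ∧ √(Ppoly α θ x) ≤ 2 * α := by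
  have hC := Ccoef_sq_le (θ := θ) hα
  have hC0 := sq_nonneg (Ccoef α θ)
  have hc1 := Real.cos_le_one (2 * θ)
  have hx0 := sq_nonneg x
  have hx4 : x ^ 4 ≤ 1 := by nlinarith
  have hx40 : 0 ≤ x ^ 4 := by positivity
  have h1 : Ccoef α θ ^ 2 * x ^ 4 ≤ 1 / 4 := by nlinarith
  have h2 : 0 ≤ Ccoef α θ ^ 2 * x ^ 4 := by positivity
  have h3 : 0 ≤ Real.cos (2 * θ) * x ^ 2 := by positivity
  have h4 : Real.cos (2 * θ) * x ^ 2 ≤ 1 := by nlinarith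
  refine ⟨by rw [Ppoly]; nlinarith, Real.le_sqrt_of_sq_le ?_,
    Real.sqrt_le_iff.2 ⟨by linarith, ?_⟩⟩ <;> rw [Ppoly] <;> nlinarith

/-- The numerator of the integrand of `Lint`. -/
noncomputable def periodNum (α θ x : ℝ) : ℝ :=
  2 * α * Ccoef α θ ^ 2 * x ^ 2 - α * Real.cos (2 * θ)
    + Ccoef α θ ^ 2 * x ^ 2 * √(Ppoly α θ x)

/-- The integrand of `Lint` in the variable `x = cos t`. -/
noncomputable def periodFun (α θ t : ℝ) : ℝ :=
  periodNum α θ (Real.cos t) /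
    (√(Ppoly α θ (Real.cos t)) * (α + √(Ppoly α θ (Real.cos t))))

lemma Lint_eq_integral_periodFun (α θ : ℝ) :
    Lint α θ = ∫ t in (0 : ℝ)..Real.pi, periodFun α θ t := by
  have h := (Polynomial.Chebyshev.integral_measureT fun x => periodNum α θ x /
    (√(Ppoly α θ x) * (α + √(Ppoly α θ x)))).symm.trans
      Polynomial.Chebyshev.integral_measureT_eq_integral_cos
  simp only [periodFun]
  rw [← h, Lint]
  refine intervalIntegral.integral_congr fun x hx => ?_
  rw [Set.uIcc_of_le (by norm_num)] at hx
  have hx' : 0 ≤ 1 - x ^ 2 := by nlinarith [hx.1, hx.2]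
  simp only [periodNum, Real.sqrt_mul hx', Real.sqrt_inv]
  rw [← div_eq_mul_inv, div_div]
  congr 1
  ring

lemma continuous_periodFun {α θ : ℝ} (hα : 1 ≤ α) (hc : 0 ≤ Real.cos (2 * θ)) :
    Continuous (periodFun α θ) := by
  have hP : Continuous fun t => √(Ppoly α θ (Real.cos t)) := by
    simp only [Ppoly]; fun_prop
  unfold periodFun periodNum
  refine Continuous.div (by fun_prop) (by fun_prop) fun t => ?_
  obtain ⟨-, h, -⟩ := sqrt_Ppoly_bounds hα hc (Real.cos_sq_le_one t)
  have : 0 < √(Ppoly α θ (Real.cos t)) := by linarith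
  positivity

lemma periodic_periodFun (α θ : ℝ) : Function.Periodic (periodFun α θ) Real.pi := by
  intro t
  simp only [periodFun, periodNum, Ppoly, Real.cos_add_pi, neg_sq,
    Even.neg_pow (by decide : Even 4)]

lemma cos_two_mul_le_of_Lint_eq_zero {α θ : ℝ} (hα : 1 ≤ α) (hc : 0 ≤ Real.cos (2 * θ))
    (hL : Lint α θ = 0) : Real.cos (2 * θ) ≤ 4 * Ccoef α θ ^ 2 := by
  by_contra! hlt
  have hpos : 0 < ∫ t in (0 : ℝ)..Real.pi, -periodFun α θ t := by
    refine intervalIntegral.intervalIntegral_pos_of_pos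
      ((continuous_periodFun hα hc).neg.intervalIntegrable _ _) (fun t => ?_) Real.pi_pos
    obtain ⟨-, h1, h2⟩ := sqrt_Ppoly_bounds hα hc (Real.cos_sq_le_one t)
    have hs : 0 < √(Ppoly α θ (Real.cos t)) := by linarith
    rw [periodFun, ← neg_div]
    refine div_pos ?_ (by positivity)
    rw [periodNum]
    have hx := Real.cos_sq_le_one t
    have hk : Ccoef α θ ^ 2 * Real.cos t ^ 2 ≤ Ccoef α θ ^ 2 :=
      mul_le_of_le_one_right (sq_nonneg _) hx
    have hk0 : 0 ≤ Ccoef α θ ^ 2 * Real.cos t ^ 2 := by positivity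
    nlinarith
  rw [intervalIntegral.integral_neg, ← Lint_eq_integral_periodFun, hL] at hpos
  simp at hpos

lemma abs_periodFun_le {α θ : ℝ} (hα : 1 ≤ α) (hc : 0 ≤ Real.cos (2 * θ))
    (hL : Lint α θ = 0) (t : ℝ) : |periodFun α θ t| ≤ 8 * Ccoef α θ ^ 2 := by
  obtain ⟨-, h1, h2⟩ := sqrt_Ppoly_bounds hα hc (Real.cos_sq_le_one t)
  have hcC := cos_two_mul_le_of_Lint_eq_zero hα hc hL
  have hx := Real.cos_sq_le_one t
  have hk : Ccoef α θ ^ 2 * Real.cos t ^ 2 ≤ Ccoef α θ ^ 2 :=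
    mul_le_of_le_one_right (sq_nonneg _) hx
  have hk0 : 0 ≤ Ccoef α θ ^ 2 * Real.cos t ^ 2 := by positivity
  have hC0 := sq_nonneg (Ccoef α θ)
  have hnum : |periodNum α θ (Real.cos t)| ≤ 4 * α * Ccoef α θ ^ 2 := by
    rw [periodNum, abs_le]
    constructor <;> nlinarith
  have hs : 0 < √(Ppoly α θ (Real.cos t)) := by linarith
  have hden : α / 2 ≤ √(Ppoly α θ (Real.cos t)) * (α + √(Ppoly α θ (Real.cos t))) := by
    nlinarith
  rw [periodFun, abs_div, abs_of_pos (by positivity : 0 < √(Ppoly α θ (Real.cos t)) *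
    (α + √(Ppoly α θ (Real.cos t)))), div_le_iff₀ (by positivity)]
  nlinarith

lemma neg_of_continuous_of_sq_pos {f : ℝ → ℝ} (hf : Continuous f) (h : ∀ u, 0 < f u ^ 2)
    (h0 : f 0 ≤ 0) (u : ℝ) : f u < 0 := by
  by_contra! hu
  obtain ⟨v, hv⟩ := mem_range_of_exists_le_of_exists_ge hf ⟨0, h0⟩ ⟨u, hu⟩
  have := h v
  simp [hv] at this

lemma abs_curve_le {α C g k s p M S : ℝ} (hα : 1 ≤ α) (hC : |C| ≤ 1) (hg : |g| ≤ 1)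
    (hk : |k| ≤ 1) (hs : |s| ≤ 1) (hp : |p| ≤ M) (hS : |S| ≤ M) :
    |g / α * k * S - C / α * s * p| +
      |C / α * (g / α - 1) * k * p - 1 / α * (C ^ 2 / α + g) * s * S| ≤ 6 * M / α := by
  have hα0 : 0 < α := by linarith
  have hM : 0 ≤ M := (abs_nonneg _).trans hp
  have hα1 : 1 / α ≤ 1 := (div_le_one hα0).2 hα
  have hgα : |g / α| ≤ 1 := by
    rw [abs_div, abs_of_pos hα0]; exact (div_le_one hα0).2 (hg.trans hα)
  have hCα : |C ^ 2 / α| ≤ 1 := by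
    rw [abs_div, abs_of_pos hα0, abs_pow]
    exact (div_le_one hα0).2 ((pow_le_one₀ (abs_nonneg _) hC).trans hα)
  have key : ∀ {a b c m : ℝ}, |a| ≤ m → |b| ≤ 1 → |c| ≤ M → |a * b * c| ≤ m * M := by
    intro a b c m ha hb hc
    rw [abs_mul, abs_mul]
    have : |a| * |b| ≤ m := (mul_le_of_le_one_right (abs_nonneg _) hb).trans ha
    exact mul_le_mul this hc (abs_nonneg _) ((abs_nonneg _).trans ha)
  have h1 := key hg hk hS
  have h2 := key hC hs hp
  have h3 : |C * (g / α - 1)| ≤ 2 := by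
    rw [abs_mul]
    have := abs_sub (g / α) 1
    rw [abs_one] at this
    nlinarith [abs_nonneg C, abs_nonneg (g / α - 1)]
  have h4 : |C ^ 2 / α + g| ≤ 2 := (abs_add_le _ _).trans (by linarith)
  have h5 := key h3 hk hp
  have h6 := key h4 hs hS
  have e1 : g / α * k * S - C / α * s * p = (g * k * S - C * s * p) / α := by ring
  have e2 : C / α * (g / α - 1) * k * p - 1 / α * (C ^ 2 / α + g) * s * S =
      (C * (g / α - 1) * k * p - (C ^ 2 / α + g) * s * S) / α := by ring
  rw [e1, e2, abs_div, abs_div, abs_of_pos hα0, ← add_div]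
  gcongr
  have h7 := abs_sub (g * k * S) (C * s * p)
  have h8 := abs_sub (C * (g / α - 1) * k * p) ((C ^ 2 / α + g) * s * S)
  linarith

/-- The curve `y₂ = 0` on the horizontal catenoid `𝒞_α` converges uniformly to the origin
as `α → +∞`: `sup_u (|y₁^α(u)| + |y₃^α(u)|) → 0`. -/
theorem statement_17 (θt Ct : ℝ → ℝ) (φf φd βf Gf Gd : ℝ → ℝ → ℝ)
    (Aα y₁ y₃ : ℝ → ℝ → ℝ)
    (hθt : ∀ α : ℝ, 0 < α →
      θt α ∈ Set.Ioo 0 (thetaPlus α) ∩ Set.Ioo 0 (Real.pi / 4) ∧ Lint α (θt α) = 0)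
    (hCt : ∀ α : ℝ, 0 < α → Ct α = Real.sin (2 * θt α) / (2 * α))
    (hφ : ∀ α : ℝ, 0 < α → ∀ u, HasDerivAt (φf α) (φd α u) u)
    (hφc : ∀ α : ℝ, 0 < α → Continuous (φd α))
    (hode : ∀ α : ℝ, 0 < α → ∀ u, (φd α u) ^ 2 = Ppoly α (θt α) (Real.cos (φf α u)))
    (hφ0 : ∀ α : ℝ, 0 < α → φf α 0 = 0) (hφd0 : ∀ α : ℝ, 0 < α → φd α 0 ≤ 0)
    (hβ : ∀ α : ℝ, 0 < α → ∀ u, HasDerivAt (βf α) (Ct α * Real.cos (φf α u) ^ 2) u)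
    (hβ0 : ∀ α : ℝ, 0 < α → βf α 0 = 0)
    (hGd : ∀ α : ℝ, 0 < α → ∀ u, Gd α u =
      (Ct α ^ 2 * Real.cos (φf α u) ^ 2 - Real.cos (2 * θt α)) / (α - φd α u))
    (hG : ∀ α : ℝ, 0 < α → ∀ u, HasDerivAt (Gf α) (Gd α u) u)
    (hG0 : ∀ α : ℝ, 0 < α → Gf α 0 = 0)
    (hA : ∀ α u : ℝ, Aα α u = βf α u + α / Ct α * Gf α u)
    (hy₁ : ∀ α u : ℝ, y₁ α u =
      Gd α u / α * Real.cos (φf α u) * Real.sinh (Aα α u)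
        - Ct α / α * Real.sin (φf α u) * Real.cosh (Aα α u))
    (hy₃ : ∀ α u : ℝ, y₃ α u =
      Ct α / α * (Gd α u / α - 1) * Real.cos (φf α u) * Real.cosh (Aα α u)
        - 1 / α * (Ct α ^ 2 / α + Gd α u) * Real.sin (φf α u) * Real.sinh (Aα α u)) :
    TendstoUniformly (fun α u => |y₁ α u| + |y₃ α u|) (fun _ => 0) Filter.atTop := by
  rw [Metric.tendstoUniformly_iff]
  intro ε hε
  set M := Real.cosh (4 * Real.pi) with hM
  have hlim : Tendsto (fun α : ℝ => 6 * M / α) atTop (nhds 0) :=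
    tendsto_const_nhds.div_atTop tendsto_id
  filter_upwards [eventually_ge_atTop 1, hlim.eventually_lt_const hε] with α hα hαε u
  rw [Real.dist_eq, zero_sub, abs_neg, abs_of_nonneg (by positivity)]
  refine lt_of_le_of_lt ?_ hαε
  have hα0 : 0 < α := by linarith
  obtain ⟨⟨⟨hθ0, -⟩, -, hθ1⟩, hL⟩ := hθt α hα0
  have hCeq : Ct α = Ccoef α (θt α) := hCt α hα0
  have hsin : 0 < Real.sin (2 * θt α) :=
    Real.sin_pos_of_pos_of_lt_pi (by linarith) (by linarith [Real.pi_pos])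
  have hc : 0 ≤ Real.cos (2 * θt α) :=
    (Real.cos_pos_of_mem_Ioo ⟨by linarith [Real.pi_pos], by linarith⟩).le
  have hC0 : 0 < Ct α := by rw [hCt α hα0]; positivity
  have hC2 : Ct α ^ 2 ≤ 1 / 4 := hCeq ▸ Ccoef_sq_le hα
  have hC1 : Ct α ≤ 1 / 2 := by nlinarith
  have hcC : Real.cos (2 * θt α) ≤ 4 * Ct α ^ 2 :=
    hCeq ▸ cos_two_mul_le_of_Lint_eq_zero hα hc hL
  have hneg : ∀ v, φd α v < 0 :=
    neg_of_continuous_of_sq_pos (hφc α hα0) (fun v => by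
      rw [hode α hα0]
      exact (sqrt_Ppoly_bounds hα hc (Real.cos_sq_le_one _)).1) (hφd0 α hα0)
  have hφd : ∀ v, φd α v = -√(Ppoly α (θt α) (Real.cos (φf α v))) := fun v => by
    rw [← hode α hα0, Real.sqrt_sq_eq_abs, abs_of_neg (hneg v), neg_neg]
  have hcont := continuous_periodFun hα hc
  have hAeq : ∀ v, Aα α v = -(1 / Ct α) * ∫ τ in (0 : ℝ)..φf α v, periodFun α (θt α) τ := by
    have hd : ∀ v, HasDerivAt (fun v => Aα α v +
        1 / Ct α * ∫ τ in (0 : ℝ)..φf α v, periodFun α (θt α) τ) 0 v := by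
      intro v
      have hI := ((hcont.integral_hasStrictDerivAt 0 (φf α v)).hasDerivAt.comp v
        (hφ α hα0 v)).const_mul (1 / Ct α)
      have hA' := ((hβ α hα0 v).add ((hG α hα0 v).const_mul (α / Ct α))).add hI
      have hfun : (fun v => Aα α v +
          1 / Ct α * ∫ τ in (0 : ℝ)..φf α v, periodFun α (θt α) τ) =
          fun v => βf α v + α / Ct α * Gf α v +
            1 / Ct α * ∫ τ in (0 : ℝ)..φf α v, periodFun α (θt α) τ := by
        funext w; rw [hA]
      rw [hfun]
      refine hA'.congr_deriv ?_
      obtain ⟨-, h1, -⟩ := sqrt_Ppoly_bounds hα hc (Real.cos_sq_le_one (φf α v))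
      rw [hGd α hα0, hφd, periodFun, periodNum, ← hCeq]
      have hs : 0 < √(Ppoly α (θt α) (Real.cos (φf α v))) := by linarith
      generalize √(Ppoly α (θt α) (Real.cos (φf α v))) = S at hs
      have hS : α - -S ≠ 0 := by linarith
      have hS' : α + S ≠ 0 := by linarith
      rw [sub_neg_eq_add]
      field_simp
      ring
    intro v
    have h := is_const_of_deriv_eq_zero (fun v => (hd v).differentiableAt)
      (fun v => (hd v).deriv) v 0
    simp only [hA α 0, hβ0 α hα0, hG0 α hα0, hφ0 α hα0, intervalIntegral.integral_same] at h
    linarith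
  have hAbd : |Aα α u| ≤ 4 * Real.pi := by
    have h := abs_integral_le_of_periodic_of_integral_eq_zero Real.pi_pos hcont
      (periodic_periodFun α (θt α)) (by rw [← Lint_eq_integral_periodFun, hL])
      (abs_periodFun_le hα hc hL) (φf α u)
    rw [hAeq, abs_mul, abs_neg, abs_of_pos (by positivity : 0 < 1 / Ct α), one_div_mul_eq_div,
      div_le_iff₀ hC0]
    rw [← hCeq] at h
    nlinarith [Real.pi_pos, mul_pos Real.pi_pos hC0]
  have hcosh : Real.cosh (Aα α u) ≤ M := by
    rw [hM, Real.cosh_le_cosh]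
    exact hAbd.trans (le_abs_self _)
  have hsinh : |Real.sinh (Aα α u)| ≤ M := by
    refine le_trans ?_ hcosh
    rw [Real.abs_sinh, ← Real.cosh_abs]
    exact (Real.sinh_lt_cosh _).le
  have hg : |Gd α u| ≤ 1 := by
    have hd : 1 ≤ α - φd α u := by linarith [hneg u]
    rw [hGd α hα0, abs_div, abs_of_pos (by linarith : 0 < α - φd α u),
      div_le_one (by linarith)]
    refine le_trans ?_ hd
    have hk : Ct α ^ 2 * Real.cos (φf α u) ^ 2 ≤ Ct α ^ 2 :=
      mul_le_of_le_one_right (sq_nonneg _) (Real.cos_sq_le_one _)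
    have hk0 : 0 ≤ Ct α ^ 2 * Real.cos (φf α u) ^ 2 := by positivity
    rw [abs_le]
    constructor <;> linarith
  rw [hy₁, hy₃]
  exact abs_curve_le hα (by rw [abs_of_pos hC0]; linarith) hg (Real.abs_cos_le_one _)
    (Real.abs_sin_le_one _) (by rwa [abs_of_pos (Real.cosh_pos _)]) hsinh
end

section
/- Let α > 0 and set α_* = √(α² + 1). Let φ : ℝ → ℝ be a C¹ function with φ'(u)² = α² + cos²φ(u) for all u, φ(0) = 0 and φ'(u) < 0 for all u; let φ_* : ℝ → ℝ be a C¹ function with φ_*'(u)² = α_*² − cos²φ_*(u) for all u, φ_*(0) = 0 and φ_*'(u) < 0 for all u. Then for all u ∈ ℝ: cos²φ_*(u) · φ'(u)² = α_*² · cos²φ(u). (Equivalently, φ'²/cos²φ = α_*²/cos²φ_*, so the harmonic maps g and g_* built from φ and φ_* satisfy cosh ω = cosh ω_* and are conjugate.) -/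
open Real Filter

/-- A negative square root of a differentiable function is differentiable. -/
theorem hasDerivAt_of_sq_eq_of_neg {f g : ℝ → ℝ} {k u : ℝ} (hfg : ∀ x, f x ^ 2 = g x)
    (hf : ∀ x, f x < 0) (hg : HasDerivAt g (2 * f u * k) u) : HasDerivAt f k u := by
  have hsqrt : f = fun x => -Real.sqrt (g x) := by
    funext x
    rw [← hfg x, Real.sqrt_sq_eq_abs, abs_of_neg (hf x), neg_neg]
  have hne : f u ≠ 0 := (hf u).ne
  have hd := (hg.sqrt (by rw [← hfg u]; positivity)).neg
  have hval : Real.sqrt (g u) = -f u := by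
    rw [← hfg u, Real.sqrt_sq_eq_abs, abs_of_neg (hf u)]
  rw [hval] at hd
  rw [hsqrt]
  refine hd.congr_deriv ?_
  field_simp

/-- Grönwall: a nonnegative function with `|E'| ≤ K E` and a zero vanishes identically. -/
theorem eq_zero_of_abs_deriv_le_mul {E E' : ℝ → ℝ} {K : ℝ}
    (hE : ∀ u, HasDerivAt E (E' u) u) (hnn : ∀ u, 0 ≤ E u)
    (hbound : ∀ u, |E' u| ≤ K * E u) (h0 : E 0 = 0) (u : ℝ) : E u = 0 := by
  have hd : ∀ c v : ℝ, HasDerivAt (fun x => E x * Real.exp (c * x))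
      ((E' v + c * E v) * Real.exp (c * v)) v := by
    intro c v
    have hexp : HasDerivAt (fun x => Real.exp (c * x)) (Real.exp (c * v) * (c * 1)) v :=
      ((hasDerivAt_id v).const_mul c).exp
    exact ((hE v).mul hexp).congr_deriv (by ring)
  have hanti : Antitone (fun x => E x * Real.exp (-K * x)) := by
    refine antitone_of_deriv_nonpos (fun v => (hd (-K) v).differentiableAt) fun v => ?_
    rw [(hd (-K) v).deriv]
    exact mul_nonpos_of_nonpos_of_nonneg (by linarith [(abs_le.mp (hbound v)).2])
      (Real.exp_pos _).le
  have hmono : Monotone (fun x => E x * Real.exp (K * x)) := by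
    refine monotone_of_deriv_nonneg (fun v => (hd K v).differentiableAt) fun v => ?_
    rw [(hd K v).deriv]
    exact mul_nonneg (by linarith [(abs_le.mp (hbound v)).1]) (Real.exp_pos _).le
  refine le_antisymm ?_ (hnn u)
  rcases le_total 0 u with hu | hu
  · have h := hanti hu
    simp only [h0, zero_mul] at h
    exact nonpos_of_mul_nonpos_left h (Real.exp_pos _)
  · have h := hmono hu
    simp only [h0, zero_mul] at h
    exact nonpos_of_mul_nonpos_left h (Real.exp_pos _)

/-- Solutions of `t' = c p`, `c' = -t p`, `p' = t c` with bounded second component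
are determined by their value at `0`. -/
theorem second_component_unique {t c p T C P : ℝ → ℝ}
    (ht : ∀ u, HasDerivAt t (c u * p u) u) (hc : ∀ u, HasDerivAt c (-(t u * p u)) u)
    (hp : ∀ u, HasDerivAt p (t u * c u) u)
    (hT : ∀ u, HasDerivAt T (C u * P u) u) (hC : ∀ u, HasDerivAt C (-(T u * P u)) u)
    (hP : ∀ u, HasDerivAt P (T u * C u) u)
    (hcb : ∀ u, |c u| ≤ 1) (hCb : ∀ u, |C u| ≤ 1)
    (ht0 : t 0 = T 0) (hc0 : c 0 = C 0) (hp0 : p 0 = P 0) (u : ℝ) : c u = C u := by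
  have hE : ∀ v, HasDerivAt
      (fun x => (t x - T x) ^ 2 + (c x - C x) ^ 2 + (p x - P x) ^ 2)
      (2 * ((t v - T v) * (p v - P v) * (C v + c v))) v := by
    intro v
    exact (((((ht v).sub (hT v)).pow 2).add (((hc v).sub (hC v)).pow 2)).add
      (((hp v).sub (hP v)).pow 2)).congr_deriv (by simp; ring)
  have hz := eq_zero_of_abs_deriv_le_mul (K := 2) hE (fun v => by positivity) (fun v => by
    have hsum : |C v + c v| ≤ 2 := (abs_add_le _ _).trans (by linarith [hcb v, hCb v])
    rw [abs_mul, abs_mul, abs_mul, abs_two]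
    have h := mul_le_mul_of_nonneg_left hsum
      (mul_nonneg (abs_nonneg (t v - T v)) (abs_nonneg (p v - P v)))
    nlinarith [sq_nonneg (|t v - T v| - |p v - P v|), sq_abs (t v - T v), sq_abs (p v - P v),
      sq_nonneg (c v - C v)]) (by simp [ht0, hc0, hp0]) u
  have hsq : (c u - C u) ^ 2 = 0 := by
    nlinarith [sq_nonneg (t u - T u), sq_nonneg (c u - C u), sq_nonneg (p u - P u)]
  exact sub_eq_zero.mp (pow_eq_zero_iff two_ne_zero |>.mp hsq)

/-- The profile functions `φ` and `φ_*` of the conjugate harmonic maps satisfy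
`cos²φ_* · φ'² = α_*² · cos²φ`, i.e. `φ'²/cos²φ = α_*²/cos²φ_*`. -/
theorem statement_18 {α : ℝ} (hα : 0 < α) (αs : ℝ) (hαs : αs = Real.sqrt (α ^ 2 + 1))
    (φ φd φs φsd : ℝ → ℝ)
    (hφ : ∀ u, HasDerivAt φ (φd u) u) (hφc : Continuous φd)
    (hode : ∀ u, (φd u) ^ 2 = α ^ 2 + Real.cos (φ u) ^ 2)
    (hφ0 : φ 0 = 0) (hφneg : ∀ u, φd u < 0)
    (hφs : ∀ u, HasDerivAt φs (φsd u) u) (hφsc : Continuous φsd)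
    (hsode : ∀ u, (φsd u) ^ 2 = αs ^ 2 - Real.cos (φs u) ^ 2)
    (hφs0 : φs 0 = 0) (hφsneg : ∀ u, φsd u < 0) :
    ∀ u, Real.cos (φs u) ^ 2 * (φd u) ^ 2 = αs ^ 2 * Real.cos (φ u) ^ 2 := by
  have hαs2 : αs ^ 2 = α ^ 2 + 1 := by rw [hαs, Real.sq_sqrt (by positivity)]
  have hαs0 : 0 < αs := by rw [hαs]; positivity
  have hne : ∀ u, φd u ≠ 0 := fun u => (hφneg u).ne
  have hφd : ∀ u, HasDerivAt φd (-(Real.sin (φ u) * Real.cos (φ u))) u := fun u =>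
    hasDerivAt_of_sq_eq_of_neg hode hφneg
      ((((hφ u).cos.pow 2).const_add (α ^ 2)).congr_deriv (by simp; ring))
  have hφsd : ∀ u, HasDerivAt φsd (Real.sin (φs u) * Real.cos (φs u)) u := fun u =>
    hasDerivAt_of_sq_eq_of_neg hsode hφsneg
      ((((hφs u).cos.pow 2).const_sub (αs ^ 2)).congr_deriv (by simp; ring))
  have hd0 : φd 0 = -αs := by
    have h := hode 0
    rw [hφ0, Real.cos_zero] at h
    nlinarith [hφneg 0]
  have hsd0 : φsd 0 = -α := by
    have h := hsode 0
    rw [hφs0, Real.cos_zero] at h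
    nlinarith [hφsneg 0]
  have hCb : ∀ u, |-αs * Real.cos (φ u) / φd u| ≤ 1 := by
    intro u
    rw [← sq_le_one_iff_abs_le_one, div_pow, div_le_one (by have := hne u; positivity), hode u,
      mul_pow, neg_sq, hαs2]
    nlinarith [mul_nonneg (sq_nonneg α) (sub_nonneg.mpr (Real.cos_sq_le_one (φ u)))]
  intro u
  have key := second_component_unique
    (t := fun x => Real.sin (φs x)) (c := fun x => Real.cos (φs x)) (p := φsd)
    (T := fun x => -α * Real.sin (φ x) / φd x) (C := fun x => -αs * Real.cos (φ x) / φd x)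
    (P := fun x => α * αs / φd x)
    (fun v => (hφs v).sin) (fun v => (hφs v).cos.congr_deriv (by ring)) hφsd
    (fun v => by
      refine (((hφ v).sin.const_mul (-α)).div (hφd v) (hne v)).congr_deriv ?_
      have := hne v
      field_simp
      linear_combination (-Real.cos (φ v)) * hode v - Real.cos (φ v) * Real.sin_sq_add_cos_sq (φ v)
        + Real.cos (φ v) * hαs2)
    (fun v => by
      refine (((hφ v).cos.const_mul (-αs)).div (hφd v) (hne v)).congr_deriv ?_
      have := hne v
      field_simp
      linear_combination Real.sin (φ v) * hode v)
    (fun v => by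
      refine ((hasDerivAt_const v (α * αs)).div (hφd v) (hne v)).congr_deriv ?_
      have := hne v
      field_simp
      ring)
    (fun v => Real.abs_cos_le_one _) hCb
    (by simp [hφ0, hφs0]) (by simp [hφ0, hφs0, hd0, hαs0.ne'])
    (by simp only [hd0, hsd0]; field_simp) u
  have := hne u
  rw [key]
  field_simp
end
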